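/- There is a constant C_n < ∞ depending only on n such that for every T > 0 and every t ≥ T, |I(t)| ≤ 2 η_T F(t) + C_n V(t), where η_T := sup_{s ≥ T} ε(s) and V(t) := Σ_{k≥0} 2^{−k(n+2)} F₀(t + k log 2) ∫_t^{t + k log 2} F(τ) dτ. -/

import Mathlib

open MeasureTheory Metric Filter Topology Pointwise

noncomputable section

abbrev En (n : ℕ) := EuclideanSpace ℝ (Fin n)

/-- symmetric trace-free matrices -/
def S0 {n : ℕ} (B : Matrix (Fin n) (Fin n) ℝ) : Prop := B.IsSymm ∧ B.trace = 0

/-- ψ_B(x) = (1/2) x·Bx -/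
def psiM {n : ℕ} (B : Matrix (Fin n) (Fin n) ℝ) (x : En n) : ℝ :=
  (1/2) * ∑ i, ∑ j, B i j * x i * x j

/-- p₀(x) = |x|²/(2n) -/
def p0 (n : ℕ) (x : En n) : ℝ := ‖x‖^2 / (2*n)

/-- q_B = p₀ + ψ_B -/
def qB {n : ℕ} (B : Matrix (Fin n) (Fin n) ℝ) (x : En n) : ℝ := p0 n x + psiM B x

/-- surface measure on the unit sphere -/
def sphMeas (n : ℕ) : Measure (En n) :=
  (Measure.hausdorffMeasure ((n:ℝ) - 1)).restrict (sphere (0:En n) 1)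

/-- total surface area of the unit sphere -/
def sphArea (n : ℕ) : ℝ := (sphMeas n Set.univ).toReal

/-- u is a C^{1,1} solution of Δu = χ_{|∇u|>0} in B₁ with 0 a free boundary point. -/
def SolutionHyp {n : ℕ} (u : En n → ℝ) : Prop :=
  (∀ x ∈ ball (0:En n) 1, DifferentiableAt ℝ u x) ∧
  (∃ L : NNReal, LipschitzOnWith L (fun x => gradient u x) (ball (0:En n) 1)) ∧
  (∀ᵐ x ∂(volume.restrict (ball (0:En n) 1)),
      ∃ D : En n →L[ℝ] En n, HasFDerivAt (fun y => gradient u y) D x ∧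
        ((gradient u x = 0 → LinearMap.trace ℝ (En n) (D : En n →ₗ[ℝ] En n) = 0) ∧
         (gradient u x ≠ 0 → LinearMap.trace ℝ (En n) (D : En n →ₗ[ℝ] En n) = 1))) ∧
  ((0:En n) ∈ frontier {x | x ∈ ball (0:En n) 1 ∧ gradient u x ≠ 0}) ∧
  gradient u 0 = 0

/-- the quadratic rescaling u_t(x) = e^{2t}(u(e^{-t}x)-u(0)) -/
def ut {n : ℕ} (u : En n → ℝ) (t : ℝ) (x : En n) : ℝ :=
  Real.exp (2*t) * (u (Real.exp (-t) • x) - u 0)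

/-- Λ = {x ∈ B₁ : ∇u(x)=0} -/
def Lam {n : ℕ} (u : En n → ℝ) : Set (En n) :=
  {x | x ∈ ball (0:En n) 1 ∧ gradient u x = 0}

/-- Λ_t = e^t Λ -/
def LamT {n : ℕ} (u : En n → ℝ) (t : ℝ) : Set (En n) := Real.exp t • Lam u

/-- B(t) is the L²(∂B₁)-projection coefficient of u_t - p₀ -/
def BProp {n : ℕ} (u : En n → ℝ) (B : ℝ → Matrix (Fin n) (Fin n) ℝ) : Prop :=
  ∀ t, 0 < t → S0 (B t) ∧
    ∀ C, S0 C →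
      ∫ x, (ut u t x - p0 n x - psiM (B t) x) * psiM C x ∂(sphMeas n) = 0

/-- remainder R_t = u_t - q_{B(t)} -/
def Rt {n : ℕ} (u : En n → ℝ) (B : ℝ → Matrix (Fin n) (Fin n) ℝ) (t : ℝ) (x : En n) : ℝ :=
  ut u t x - qB (B t) x

/-- F(t) = ∫_{Λ_t ∩ B₁} |x|² dx -/
def Fdef {n : ℕ} (u : En n → ℝ) (t : ℝ) : ℝ :=
  ∫ x in LamT u t ∩ ball (0:En n) 1, ‖x‖^2

/-- I(t) = ∫_{Λ_t ∩ B₁} x·∇R_t dx -/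
def Idef {n : ℕ} (u : En n → ℝ) (B : ℝ → Matrix (Fin n) (Fin n) ℝ) (t : ℝ) : ℝ :=
  ∫ x in LamT u t ∩ ball (0:En n) 1, ∑ i, x i * gradient (Rt u B t) x i

/-- the origin is a singular point -/
def IsSingular {n : ℕ} (u : En n → ℝ) : Prop :=
  ∃ (r : ℕ → ℝ) (Bstar : Matrix (Fin n) (Fin n) ℝ),
    (∀ k, 0 < r k) ∧ Tendsto r atTop (nhds 0) ∧ S0 Bstar ∧
    (∀ K : Set (En n), IsCompact K →
      TendstoUniformlyOn (fun k x => (u (r k • x) - u 0) / (r k)^2) (qB Bstar) atTop K ∧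
      TendstoUniformlyOn (fun k x => gradient (fun y => (u (r k • y) - u 0) / (r k)^2) x)
        (fun x => gradient (qB Bstar) x) atTop K)

/-- Frobenius norm -/
def frob {n : ℕ} (M : Matrix (Fin n) (Fin n) ℝ) : ℝ := Real.sqrt (∑ i, ∑ j, (M i j)^2)

/-- the annulus 1/2 < |x| < 1 -/
def ann0 (n : ℕ) : Set (En n) := {x | 1/2 < ‖x‖ ∧ ‖x‖ < 1}

/-- the dyadic annulus 2^{-k-1} < |x| < 2^{-k} -/
def annK (n : ℕ) (k : ℕ) : Set (En n) :=
  {x | (2:ℝ)^(-(k:ℤ)-1) < ‖x‖ ∧ ‖x‖ < (2:ℝ)^(-(k:ℤ))}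

def F0 {n : ℕ} (u : En n → ℝ) (t : ℝ) : ℝ := ∫ x in LamT u t ∩ ann0 n, ‖x‖^2

def Fk {n : ℕ} (u : En n → ℝ) (k : ℕ) (t : ℝ) : ℝ := ∫ x in LamT u t ∩ annK n k, ‖x‖^2

def I0 {n : ℕ} (u : En n → ℝ) (B : ℝ → Matrix (Fin n) (Fin n) ℝ) (t : ℝ) : ℝ :=
  ∫ x in LamT u t ∩ ann0 n, ∑ i, x i * gradient (Rt u B t) x i

def Ik {n : ℕ} (u : En n → ℝ) (B : ℝ → Matrix (Fin n) (Fin n) ℝ) (k : ℕ) (t : ℝ) : ℝ :=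
  ∫ x in LamT u t ∩ annK n k, ∑ i, x i * gradient (Rt u B t) x i

/-- ε(t) = sup_{1/2 ≤ |x| ≤ 1} |∇R_t(x)| -/
def epsd {n : ℕ} (u : En n → ℝ) (B : ℝ → Matrix (Fin n) (Fin n) ℝ) (t : ℝ) : ℝ :=
  ⨆ x ∈ {x : En n | 1/2 ≤ ‖x‖ ∧ ‖x‖ ≤ 1}, ‖gradient (Rt u B t) x‖

/-- trace-free part of a matrix -/
def tf {n : ℕ} (M : Matrix (Fin n) (Fin n) ℝ) : Matrix (Fin n) (Fin n) ℝ :=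
  Matrix.of fun i j => M i j - (M.trace / n) * (if i = j then 1 else 0)

/-- second moment matrix of Λ_t ∩ B₁ -/
def momMat {n : ℕ} (u : En n → ℝ) (t : ℝ) : Matrix (Fin n) (Fin n) ℝ :=
  Matrix.of fun i j => ∫ x in LamT u t ∩ ball (0:En n) 1, x i * x j

/-- V(t) -/
def Vdef {n : ℕ} (u : En n → ℝ) (t : ℝ) : ℝ :=
  ∑' k : ℕ, (2:ℝ)^(-((k * (n+2) : ℕ) : ℤ)) * F0 u (t + k * Real.log 2) *
    ∫ τ in t..(t + k * Real.log 2), Fdef u τ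

/-- The unit sphere of `ℝⁿ` has finite `(n-1)`-dimensional Hausdorff measure. -/
theorem sphMeas_univ_lt_top (n : ℕ) (hn : 2 ≤ n) : sphMeas n Set.univ < ⊤ := by
  obtain ⟨m, rfl⟩ : ∃ m, n = m + 1 := ⟨n - 1, by omega⟩
  have hd : (((m + 1 : ℕ) : ℝ) - 1) = (Fintype.card (Fin m) : ℝ) := by simp
  rw [sphMeas, Measure.restrict_apply_univ, hd]
  let φ : Fin (m + 1) × Bool → (Fin m → ℝ) → En (m + 1) := fun p y =>
    WithLp.toLp 2 (p.1.insertNth (if p.2 then (1 : ℝ) else -1) y)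
  let K : Set (Fin m → ℝ) := Set.Icc (fun _ => -1) (fun _ => 1)
  have hφ1 : ∀ p y, 1 ≤ ‖φ p y‖ := by
    intro p y
    have h : ‖φ p y p.1‖ ≤ ‖φ p y‖ := PiLp.norm_apply_le _ _
    have : ‖φ p y p.1‖ = 1 := by
      rcases hp : p.2 <;> simp [φ, hp]
    linarith
  have hφ : ∀ p, ContDiff ℝ 1 (φ p) := by
    intro p
    rw [contDiff_euclidean]
    intro i
    rcases Fin.eq_self_or_eq_succAbove p.1 i with h | ⟨j, h⟩
    · subst h; simp only [φ, Fin.insertNth_apply_same]; exact contDiff_const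
    · subst h; simp only [φ, Fin.insertNth_apply_succAbove]; fun_prop
  have hψ : ∀ p, ContDiff ℝ 1 (fun y => ‖φ p y‖⁻¹ • φ p y) := by
    intro p
    have h0 : ∀ y, φ p y ≠ 0 := fun y h => by
      have := hφ1 p y; rw [h, norm_zero] at this; linarith
    exact (((hφ p).norm ℝ h0).inv (fun y => norm_ne_zero_iff.2 (h0 y))).smul (hφ p)
  have hK : IsCompact K := isCompact_Icc
  have hL : ∀ p, ∃ C, LipschitzOnWith C (fun y => ‖φ p y‖⁻¹ • φ p y) K := fun p =>
    ((hψ p).contDiffOn (s := K)).exists_lipschitzOnWith one_ne_zero (convex_Icc _ _) hK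
  have hcov : sphere (0 : En (m + 1)) 1 ⊆ ⋃ p, (fun y => ‖φ p y‖⁻¹ • φ p y) '' K := by
    intro x hx
    have hx1 : ‖x‖ = 1 := by simpa using hx
    obtain ⟨i, hi⟩ := Finite.exists_max (fun i => |x i|)
    have hxi : x i ≠ 0 := by
      intro h
      have : x = 0 := by
        ext j; have := hi j; rw [h, abs_zero] at this; simpa using this
      simp [this] at hx1
    have hpos : 0 < |x i| := abs_pos.2 hxi
    refine Set.mem_iUnion.2 ⟨(i, decide (0 < x i)), fun j => x (i.succAbove j) / |x i|, ?_, ?_⟩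
    · constructor <;> intro j
      · have := (abs_le.1 (hi (i.succAbove j))).1
        simp only; rw [le_div_iff₀ hpos]; linarith
      · have := (abs_le.1 (hi (i.succAbove j))).2
        simp only; rw [div_le_iff₀ hpos]; linarith
    · have key : φ (i, decide (0 < x i)) (fun j => x (i.succAbove j) / |x i|) = |x i|⁻¹ • x := by
        ext k
        rcases Fin.eq_self_or_eq_succAbove i k with h | ⟨j, h⟩
        · subst h
          rcases lt_or_gt_of_ne hxi with h | h
          · simp [φ, not_lt.2 h.le, abs_of_neg h, hxi]
          · simp [φ, h, abs_of_pos h, hxi]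
        · subst h
          simp [φ, div_eq_inv_mul]
      simp only [key, norm_smul, hx1, norm_inv, Real.norm_eq_abs, abs_abs, mul_one, inv_inv,
        smul_smul]
      rw [mul_inv_cancel₀ hpos.ne', one_smul]
  refine (measure_mono hcov).trans_lt ((measure_iUnion_le _).trans_lt ?_)
  rw [tsum_fintype]
  refine ENNReal.sum_lt_top.2 fun p _ => ?_
  obtain ⟨C, hC⟩ := hL p
  refine (hC.hausdorffMeasure_image_le (by positivity)).trans_lt ?_
  rw [hausdorffMeasure_pi_real]
  exact ENNReal.mul_lt_top (by simp) hK.measure_lt_top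

/-- The unit sphere of `ℝⁿ` has positive `(n-1)`-dimensional Hausdorff measure. -/
theorem sphMeas_univ_pos (n : ℕ) (hn : 2 ≤ n) : 0 < sphMeas n Set.univ := by
  obtain ⟨m, rfl⟩ : ∃ m, n = m + 1 := ⟨n - 1, by omega⟩
  have hd : (((m + 1 : ℕ) : ℝ) - 1) = (Fintype.card (Fin m) : ℝ) := by simp
  rw [sphMeas, Measure.restrict_apply_univ, hd]
  let π : En (m + 1) → (Fin m → ℝ) := fun x j => x j.succ
  have hπ : LipschitzWith 1 π := by
    refine LipschitzWith.of_dist_le_mul fun x y => ?_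
    rw [NNReal.coe_one, one_mul, dist_pi_le_iff dist_nonneg]
    intro j
    have : ‖(x - y) j.succ‖ ≤ ‖x - y‖ := PiLp.norm_apply_le _ _
    simpa [π, dist_eq_norm] using this
  have hcont : Continuous fun y : Fin m → ℝ => ∑ j, y j ^ 2 := by fun_prop
  let U : Set (Fin m → ℝ) := {y | ∑ j, y j ^ 2 < 1}
  have hU : IsOpen U := isOpen_lt hcont continuous_const
  have hUpos : 0 < volume U := hU.measure_pos _ ⟨0, by simp [U]⟩
  have hsub : U ⊆ π '' sphere (0 : En (m + 1)) 1 := by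
    intro y hy
    refine ⟨WithLp.toLp 2 (Fin.cons (Real.sqrt (1 - ∑ j, y j ^ 2)) y), ?_, ?_⟩
    · have hy' : ∑ j, y j ^ 2 < 1 := hy
      rw [mem_sphere_zero_iff_norm, EuclideanSpace.norm_eq, Fin.sum_univ_succ]
      simp [Real.sq_sqrt (by linarith : (0:ℝ) ≤ 1 - ∑ j, y j ^ 2)]
    · ext j; simp [π]
  have h1 := hπ.hausdorffMeasure_image_le (d := (Fintype.card (Fin m) : ℝ)) (by positivity)
    (sphere (0 : En (m + 1)) 1)
  rw [hausdorffMeasure_pi_real] at h1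
  simp only [ENNReal.coe_one, ENNReal.one_rpow, one_mul] at h1
  exact hUpos.trans_le ((measure_mono hsub).trans h1)

instance sphMeas_isFiniteMeasure (n : ℕ) [hn : Fact (2 ≤ n)] : IsFiniteMeasure (sphMeas n) :=
  ⟨sphMeas_univ_lt_top n hn.out⟩

/-- Two finite uniformly distributed Borel measures on a compact metric space are proportional
when tested against continuous functions. -/
theorem integral_eq_of_uniformly_distributed {X : Type*} [MetricSpace X] [CompactSpace X]
    [MeasurableSpace X] [BorelSpace X] (μ ν : Measure X) [IsFiniteMeasure μ] [IsFiniteMeasure ν]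
    [ν.IsOpenPosMeasure]
    (hμ : ∀ (x y : X) (r : ℝ), μ.real (ball x r) = μ.real (ball y r))
    (hν : ∀ (x y : X) (r : ℝ), ν.real (ball x r) = ν.real (ball y r))
    {f : X → ℝ} (hf : Continuous f) :
    ν.real Set.univ * ∫ x, f x ∂μ = μ.real Set.univ * ∫ x, f x ∂ν := by
  rcases isEmpty_or_nonempty X with hX | ⟨⟨x₀⟩⟩
  · simp [Measure.eq_zero_of_isEmpty μ, Measure.eq_zero_of_isEmpty ν]
  have huc := CompactSpace.uniformContinuous_of_continuous hf
  have key : ∀ ε > 0, |ν.real Set.univ * ∫ x, f x ∂μ - μ.real Set.univ * ∫ x, f x ∂ν| ≤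
      ε * (μ.real Set.univ * ν.real Set.univ) := by
    intro ε hε
    obtain ⟨r, hr, hfr⟩ := Metric.uniformContinuous_iff.1 huc ε hε
    set g := ν.real (ball x₀ r)
    set h := μ.real (ball x₀ r)
    have hg : 0 < g := ENNReal.toReal_pos (measure_ball_pos ν x₀ hr).ne' (measure_ne_top _ _)
    let D : Set (X × X) := {p | dist p.1 p.2 < r}
    have hD : MeasurableSet D := (isOpen_lt continuous_dist continuous_const).measurableSet
    have hintegral : ∀ φ : X × X → ℝ, Continuous φ → Integrable (D.indicator φ) (μ.prod ν) :=
      fun φ hφ => (hφ.integrable_of_hasCompactSupport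
        (HasCompactSupport.of_compactSpace φ)).indicator hD
    have e1 : ∀ φ : X → ℝ, Continuous φ →
        ∫ p, D.indicator (fun p => φ p.1) p ∂(μ.prod ν) = g * ∫ x, φ x ∂μ := by
      intro φ hφ
      rw [integral_prod _ (hintegral _ (by fun_prop)), ← integral_const_mul]
      refine integral_congr_ae (.of_forall fun x => ?_)
      have : (fun y => D.indicator (fun p : X × X => φ p.1) (x, y)) =
          (ball x r).indicator (fun _ => φ x) := by
        ext y; simp [Set.indicator, D, dist_comm]
      simp only [this]
      rw [integral_indicator measurableSet_ball, setIntegral_const, hν x x₀]; rfl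
    have e2 : ∀ φ : X → ℝ, Continuous φ →
        ∫ p, D.indicator (fun p => φ p.2) p ∂(μ.prod ν) = h * ∫ x, φ x ∂ν := by
      intro φ hφ
      rw [integral_prod_symm _ (hintegral _ (by fun_prop)), ← integral_const_mul]
      refine integral_congr_ae (.of_forall fun x => ?_)
      have : (fun y => D.indicator (fun p : X × X => φ p.2) (y, x)) =
          (ball x r).indicator (fun _ => φ x) := by
        ext y; simp [Set.indicator, D]
      simp only [this]
      rw [integral_indicator measurableSet_ball, setIntegral_const, hμ x x₀]; rfl
    have h1 : g * μ.real Set.univ = h * ν.real Set.univ := by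
      have a := e1 (fun _ => 1) continuous_const
      have b := e2 (fun _ => 1) continuous_const
      simp only [integral_const, smul_eq_mul, mul_one] at a b
      rw [← a, ← b]
    have h2 : |g * ∫ x, f x ∂μ - h * ∫ x, f x ∂ν| ≤ ε * (g * μ.real Set.univ) := by
      have c := e1 (fun _ => ε) continuous_const
      simp only [integral_const, smul_eq_mul] at c
      rw [← e1 f hf, ← e2 f hf, ← integral_sub (hintegral _ (by fun_prop)) (hintegral _ (by fun_prop)),
        show ε * (g * μ.real Set.univ) = g * (μ.real Set.univ * ε) by ring, ← c,
        ← Real.norm_eq_abs]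
      refine norm_integral_le_of_norm_le (hintegral (fun _ => ε) continuous_const)
        (.of_forall fun p => ?_)
      by_cases hp : p ∈ D
      · simp only [Set.indicator_of_mem hp]
        exact (hfr hp).le
      · simp [Set.indicator_of_notMem hp]
    have h3 : g * (ν.real Set.univ * ∫ x, f x ∂μ - μ.real Set.univ * ∫ x, f x ∂ν) =
        ν.real Set.univ * (g * ∫ x, f x ∂μ - h * ∫ x, f x ∂ν) := by
      linear_combination (- ∫ x, f x ∂ν) * h1
    have h4 : g * |ν.real Set.univ * ∫ x, f x ∂μ - μ.real Set.univ * ∫ x, f x ∂ν| ≤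
        g * (ε * (μ.real Set.univ * ν.real Set.univ)) := by
      rw [← abs_of_pos hg, ← abs_mul, abs_of_pos hg, h3, abs_mul, abs_of_nonneg measureReal_nonneg]
      calc _ ≤ ν.real Set.univ * (ε * (g * μ.real Set.univ)) := by gcongr
        _ = _ := by ring
    exact le_of_mul_le_mul_left h4 hg
  have hlim : Tendsto (fun ε : ℝ => ε * (μ.real Set.univ * ν.real Set.univ)) (𝓝[>] 0) (𝓝 0) := by
    have : Continuous fun ε : ℝ => ε * (μ.real Set.univ * ν.real Set.univ) := by fun_prop
    simpa using (this.tendsto 0).mono_left nhdsWithin_le_nhds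
  have := ge_of_tendsto hlim (eventually_nhdsWithin_of_forall fun ε hε => key ε hε)
  exact sub_eq_zero.1 (abs_nonpos_iff.1 this)

/-- A linear isometry carrying one unit vector to another. -/
theorem exists_linearIsometryEquiv_apply_eq {n : ℕ} {x y : En n} (h : ‖x‖ = ‖y‖) :
    ∃ e : En n ≃ₗᵢ[ℝ] En n, e x = y :=
  ⟨(ℝ ∙ (x - y))ᗮ.reflection, Submodule.reflection_sub h⟩

theorem image_ball_inter_sphere {n : ℕ} (e : En n ≃ₗᵢ[ℝ] En n) (x : En n) (r : ℝ) :
    e '' (ball x r ∩ sphere 0 1) = ball (e x) r ∩ sphere 0 1 := by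
  rw [Set.image_inter e.injective, e.image_ball, e.image_sphere, map_zero]

/-- Integration against the surface measure is a positive multiple of integration against the
spherical part of Lebesgue measure. -/
theorem exists_integral_sphMeas_eq (n : ℕ) (hn : 2 ≤ n) :
    ∃ κ : ℝ, 0 < κ ∧ ∀ f : En n → ℝ, ContinuousOn f (sphere 0 1) →
      ∫ x, f x ∂(sphMeas n) =
        κ * ∫ x : sphere (0 : En n) 1, f x ∂((volume : Measure (En n)).toSphere) := by
  have hfin := sphMeas_univ_lt_top n hn
  have hpos := sphMeas_univ_pos n hn
  rw [sphMeas, Measure.restrict_apply_univ] at hfin hpos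
  set d : ℝ := (n : ℝ) - 1
  have hS : MeasurableSet (sphere (0 : En n) 1) := isClosed_sphere.measurableSet
  let μ : Measure (sphere (0 : En n) 1) := (Measure.hausdorffMeasure d).comap Subtype.val
  let ν : Measure (sphere (0 : En n) 1) := (volume : Measure (En n)).toSphere
  have hμu : μ Set.univ = Measure.hausdorffMeasure d (sphere (0 : En n) 1) := by
    rw [comap_subtype_coe_apply hS, Set.image_univ, Subtype.range_coe]
  have : IsFiniteMeasure μ := ⟨by rwa [hμu]⟩
  have hμ : ∀ (x y : sphere (0 : En n) 1) (r : ℝ), μ.real (ball x r) = μ.real (ball y r) := by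
    intro x y r
    obtain ⟨e, he⟩ := exists_linearIsometryEquiv_apply_eq (x := x.1) (y := y.1) (by simp)
    simp only [measureReal_def, μ]
    rw [comap_subtype_coe_apply hS, comap_subtype_coe_apply hS, Subtype.image_ball,
      Subtype.image_ball, Set.ofPred_mem_eq, ← he, ← image_ball_inter_sphere,
      e.isometry.hausdorffMeasure_image (.inr e.surjective)]
  have hν : ∀ (x y : sphere (0 : En n) 1) (r : ℝ), ν.real (ball x r) = ν.real (ball y r) := by
    intro x y r
    obtain ⟨e, he⟩ := exists_linearIsometryEquiv_apply_eq (x := x.1) (y := y.1) (by simp)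
    simp only [measureReal_def, ν]
    rw [Measure.toSphere_apply' _ measurableSet_ball, Measure.toSphere_apply' _ measurableSet_ball,
      Subtype.image_ball, Subtype.image_ball, Set.ofPred_mem_eq, ← he, ← image_ball_inter_sphere]
    have : Set.Ioo (0 : ℝ) 1 • (e '' (ball x.1 r ∩ sphere 0 1)) =
        e '' (Set.Ioo (0 : ℝ) 1 • (ball x.1 r ∩ sphere 0 1)) := by
      ext z
      simp only [Set.mem_smul, Set.mem_image]
      constructor
      · rintro ⟨a, ha, _, ⟨b, hb, rfl⟩, rfl⟩
        exact ⟨a • b, ⟨a, ha, b, hb, rfl⟩, by simp⟩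
      · rintro ⟨_, ⟨a, ha, b, hb, rfl⟩, rfl⟩
        exact ⟨a, ha, e b, ⟨b, hb, rfl⟩, by simp⟩
    have hvol : ∀ s : Set (En n), volume (e.symm ⁻¹' s) = volume s := fun s =>
      MeasurePreserving.measure_preimage_equiv (f := e.symm.toMeasurableEquiv)
        e.symm.measurePreserving s
    rw [this, e.image_eq_preimage_symm, hvol]
  have : Nontrivial (En n) := by
    have : Nonempty (Fin n) := ⟨⟨0, by omega⟩⟩
    infer_instance
  have hνpos : 0 < ν.real Set.univ := by
    refine ENNReal.toReal_pos ?_ (measure_ne_top _ _)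
    rw [Ne, Measure.measure_univ_eq_zero]
    exact Measure.toSphere_ne_zero _
  have hμpos : 0 < μ.real Set.univ := by
    refine ENNReal.toReal_pos ?_ (measure_ne_top _ _)
    rw [hμu]; exact hpos.ne'
  refine ⟨μ.real Set.univ / ν.real Set.univ, by positivity, fun f hf => ?_⟩
  have h := integral_eq_of_uniformly_distributed μ ν hμ hν (f := fun x => f x)
    (continuousOn_iff_continuous_domRestrict.1 hf)
  have h2 : ∫ x, f x ∂(sphMeas n) = ∫ x : sphere (0 : En n) 1, f x ∂μ :=
    (integral_subtype_comap hS f).symm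
  rw [h2, div_mul_eq_mul_div, eq_div_iff hνpos.ne', mul_comm]
  exact h

theorem psiM_sub {n : ℕ} (A B : Matrix (Fin n) (Fin n) ℝ) (x : En n) :
    psiM (A - B) x = psiM A x - psiM B x := by
  simp [psiM, sub_mul, Finset.sum_sub_distrib, mul_sub]

theorem psiM_smul {n : ℕ} (c : ℝ) (A : Matrix (Fin n) (Fin n) ℝ) (x : En n) :
    psiM (c • A) x = c * psiM A x := by
  simp only [psiM, Matrix.smul_apply, smul_eq_mul, Finset.mul_sum]
  exact Finset.sum_congr rfl fun i _ => Finset.sum_congr rfl fun j _ => by ring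

theorem psiM_smul_right {n : ℕ} (c : ℝ) (A : Matrix (Fin n) (Fin n) ℝ) (x : En n) :
    psiM A (c • x) = c ^ 2 * psiM A x := by
  simp only [psiM, PiLp.smul_apply, smul_eq_mul, Finset.mul_sum]
  exact Finset.sum_congr rfl fun i _ => Finset.sum_congr rfl fun j _ => by ring

theorem continuous_psiM {n : ℕ} (A : Matrix (Fin n) (Fin n) ℝ) : Continuous (psiM A) := by
  unfold psiM; fun_prop

theorem frob_nonneg {n : ℕ} (A : Matrix (Fin n) (Fin n) ℝ) : 0 ≤ frob A := Real.sqrt_nonneg _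

theorem frob_sq {n : ℕ} (A : Matrix (Fin n) (Fin n) ℝ) : frob A ^ 2 = ∑ i, ∑ j, A i j ^ 2 :=
  Real.sq_sqrt (by positivity)

theorem abs_quadratic_le {n : ℕ} (A : Matrix (Fin n) (Fin n) ℝ) (x : En n) :
    |∑ i, ∑ j, A i j * x i * x j| ≤ frob A * ‖x‖ ^ 2 := by
  refine abs_le_of_sq_le_sq ?_ (mul_nonneg (frob_nonneg A) (by positivity))
  have h := Finset.sum_mul_sq_le_sq_mul_sq (Finset.univ : Finset (Fin n × Fin n))
    (fun p => A p.1 p.2) (fun p => x p.1 * x p.2)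
  have e2 : (∑ p : Fin n × Fin n, (x p.1 * x p.2) ^ 2) = (‖x‖ ^ 2) ^ 2 := by
    rw [EuclideanSpace.real_norm_sq_eq, sq (∑ i, x i ^ 2), Finset.sum_mul_sum,
      Fintype.sum_prod_type]
    simp only [mul_pow]
  rw [e2, Fintype.sum_prod_type, Fintype.sum_prod_type] at h
  rw [mul_pow, frob_sq]
  simpa only [mul_assoc] using h

theorem abs_psiM_le {n : ℕ} (A : Matrix (Fin n) (Fin n) ℝ) (x : En n) :
    |psiM A x| ≤ 1 / 2 * (frob A * ‖x‖ ^ 2) := by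
  rw [psiM, abs_mul, abs_of_pos (by norm_num : (0 : ℝ) < 1 / 2)]
  have := abs_quadratic_le A x
  linarith

theorem eq_zero_of_psiM_eq_zero {n : ℕ} {A : Matrix (Fin n) (Fin n) ℝ} (hA : A.IsSymm)
    (h : ∀ x ∈ sphere (0 : En n) 1, psiM A x = 0) : A = 0 := by
  have hall : ∀ x : En n, psiM A x = 0 := by
    intro x
    rcases eq_or_ne x 0 with rfl | hx
    · simp [psiM]
    · have hx' : ‖x‖ ≠ 0 := norm_ne_zero_iff.2 hx
      have h1 := h (‖x‖⁻¹ • x) (by simp [norm_smul, hx'])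
      rw [psiM_smul_right] at h1
      simpa [hx'] using h1
  have hdiag : ∀ i, A i i = 0 := by
    intro i
    have := hall (EuclideanSpace.single i 1)
    simpa [psiM, PiLp.single_apply] using this
  ext i j
  have := hall (EuclideanSpace.single i 1 + EuclideanSpace.single j 1)
  simp [psiM, PiLp.single_apply, mul_add, Finset.sum_add_distrib, hdiag] at this
  have h2 := hA.apply i j
  simp only [Matrix.zero_apply]
  linarith

theorem integrable_sphMeas {n : ℕ} (hn : 2 ≤ n) {f : En n → ℝ}
    (hf : ContinuousOn f (sphere 0 1)) : Integrable f (sphMeas n) := by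
  have hfin := sphMeas_univ_lt_top n hn
  rw [sphMeas, Measure.restrict_apply_univ] at hfin
  exact hf.integrableOn_of_subset_isCompact (isCompact_sphere 0 1)
    isClosed_sphere.measurableSet subset_rfl hfin.ne

/-- Coercivity of the surface integral of `ψ_A²` on symmetric matrices. -/
theorem exists_frob_sq_le_integral (n : ℕ) (hn : 2 ≤ n) :
    ∃ c : ℝ, 0 < c ∧ ∀ A : Matrix (Fin n) (Fin n) ℝ, A.IsSymm →
      c * frob A ^ 2 ≤ ∫ x, psiM A x ^ 2 ∂(sphMeas n) := by
  obtain ⟨κ, hκ, hintegral⟩ := exists_integral_sphMeas_eq n hn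
  let Q : Matrix (Fin n) (Fin n) ℝ → ℝ := fun A => ∫ x, psiM A x ^ 2 ∂(sphMeas n)
  have hQc : Continuous Q := by
    have : Fact (2 ≤ n) := ⟨hn⟩
    have : FirstCountableTopology (Matrix (Fin n) (Fin n) ℝ) :=
      inferInstanceAs (FirstCountableTopology (Fin n → Fin n → ℝ))
    have : LocallyCompactSpace (Matrix (Fin n) (Fin n) ℝ) :=
      inferInstanceAs (LocallyCompactSpace (Fin n → Fin n → ℝ))
    have h := continuous_parametric_integral_of_continuous (μ := sphMeas n)
      (f := fun (A : Matrix (Fin n) (Fin n) ℝ) (x : En n) => psiM A x ^ 2)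
      (by unfold psiM Function.uncurry; fun_prop) (isCompact_sphere (0 : En n) 1)
    have e : (sphMeas n).restrict (sphere 0 1) = sphMeas n := by
      rw [sphMeas, Measure.restrict_restrict isClosed_sphere.measurableSet, Set.inter_self]
    rwa [e] at h
  have hQpos : ∀ A : Matrix (Fin n) (Fin n) ℝ, A.IsSymm → A ≠ 0 → 0 < Q A := by
    intro A hA hA0
    have hc : Continuous fun x => psiM A x ^ 2 := (continuous_psiM A).pow 2
    simp only [Q]
    rw [hintegral _ hc.continuousOn]
    refine mul_pos hκ ?_
    have : ∃ x ∈ sphere (0 : En n) 1, psiM A x ≠ 0 := by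
      by_contra! hcon
      exact hA0 (eq_zero_of_psiM_eq_zero hA hcon)
    obtain ⟨x, hx, hne⟩ := this
    refine Continuous.integral_pos_of_hasCompactSupport_nonneg_nonzero (x := ⟨x, hx⟩)
      (hc.comp continuous_subtype_val) (HasCompactSupport.of_compactSpace _)
      (fun y => sq_nonneg _) (by simpa using hne)
  let K : Set (Matrix (Fin n) (Fin n) ℝ) := {A | A.IsSymm ∧ ∑ i, ∑ j, A i j ^ 2 = 1}
  have hK : IsCompact K := by
    have hbox : IsCompact (Set.univ.pi fun _ : Fin n => Set.univ.pi fun _ : Fin n =>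
        Set.Icc (-1 : ℝ) 1) := isCompact_univ_pi fun _ => isCompact_univ_pi fun _ => isCompact_Icc
    refine IsCompact.of_isClosed_subset hbox ?_ ?_
    · refine IsClosed.inter (isClosed_eq (by fun_prop) (by fun_prop))
        (isClosed_eq (by fun_prop) (by fun_prop))
    · rintro A ⟨-, hA⟩ i - j -
      have : A i j ^ 2 ≤ 1 := by
        rw [← hA]
        exact (Finset.single_le_sum (f := fun j => A i j ^ 2) (fun _ _ => sq_nonneg _)
          (Finset.mem_univ j)).trans (Finset.single_le_sum (f := fun i => ∑ j, A i j ^ 2)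
          (fun _ _ => by positivity) (Finset.mem_univ i))
      exact abs_le.1 ((sq_le_one_iff_abs_le_one _).1 this)
  have hlow : ∃ c : ℝ, 0 < c ∧ ∀ A ∈ K, c ≤ Q A := by
    rcases K.eq_empty_or_nonempty with h | h
    · exact ⟨1, one_pos, by simp [h]⟩
    · obtain ⟨A, hA, hmin⟩ := hK.exists_isMinOn h hQc.continuousOn
      refine ⟨Q A, hQpos A hA.1 ?_, fun A' hA' => hmin hA'⟩
      rintro rfl
      simpa using hA.2
  obtain ⟨c, hc, hcK⟩ := hlow
  refine ⟨c, hc, fun A hA => ?_⟩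
  rcases eq_or_ne (frob A) 0 with h0 | h0
  · rw [h0]; simp only [ne_eq, OfNat.ofNat_ne_zero, not_false_eq_true, zero_pow, mul_zero]
    exact integral_nonneg fun x => sq_nonneg _
  · have hmem : (frob A)⁻¹ • A ∈ K := by
      refine ⟨hA.smul _, ?_⟩
      simp only [Matrix.smul_apply, smul_eq_mul, mul_pow, ← Finset.mul_sum]
      rw [← frob_sq, ← mul_pow, inv_mul_cancel₀ h0, one_pow]
    have h1 := hcK _ hmem
    have h2 : Q ((frob A)⁻¹ • A) = (frob A)⁻¹ ^ 2 * ∫ x, psiM A x ^ 2 ∂(sphMeas n) := by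
      simp only [Q, psiM_smul, mul_pow]
      rw [integral_const_mul]
    rw [h2, inv_pow, inv_mul_eq_div, le_div_iff₀ (by positivity)] at h1
    exact h1

/-- Integration in polar coordinates. -/
theorem integral_eq_integral_toSphere {n : ℕ} (hn : 2 ≤ n) {f : En n → ℝ} (hf : Integrable f) :
    ∫ x, f x = ∫ ω : sphere (0 : En n) 1, (∫ ρ in Set.Ioi (0 : ℝ), ρ ^ (n - 1) * f (ρ • ω.1))
      ∂((volume : Measure (En n)).toSphere) := by
  have : Nontrivial (En n) := by
    have : Nonempty (Fin n) := ⟨⟨0, by omega⟩⟩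
    infer_instance
  have hdim : Module.finrank ℝ (En n) = n := by simp
  let g : sphere (0 : En n) 1 × Set.Ioi (0 : ℝ) → ℝ := fun p => f (p.2.1 • p.1.1)
  have hg : ∀ x : ({(0 : En n)}ᶜ : Set (En n)), g (homeomorphUnitSphereProd (En n) x) = f x := by
    rintro ⟨x, hx⟩
    have hx' : ‖x‖ ≠ 0 := norm_ne_zero_iff.2 hx
    simp [g, smul_smul, hx']
  have hmp := (volume : Measure (En n)).measurePreserving_homeomorphUnitSphereProd
  rw [hdim] at hmp
  have hemb := (homeomorphUnitSphereProd (En n)).measurableEmbedding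
  have hgi : Integrable g ((volume : Measure (En n)).toSphere.prod (.volumeIoiPow (n - 1))) := by
    rw [← hmp.integrable_comp_emb hemb]
    have : g ∘ homeomorphUnitSphereProd (En n) = f ∘ Subtype.val := funext hg
    rw [this, ← integrableOn_iff_comap_subtypeVal (measurableSet_singleton _).compl]
    exact hf.integrableOn
  calc ∫ x, f x = ∫ x : ({(0 : En n)}ᶜ : Set (En n)), f x ∂((volume : Measure (En n)).comap (↑)) := by
        rw [integral_subtype_comap (measurableSet_singleton _).compl f,
          restrict_compl_singleton]
    _ = ∫ p, g p ∂((volume : Measure (En n)).toSphere.prod (.volumeIoiPow (n - 1))) := by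
        rw [← hmp.integral_comp hemb]
        exact integral_congr_ae (.of_forall fun x => (hg x).symm)
    _ = _ := by
        rw [integral_prod _ hgi]
        refine integral_congr_ae (.of_forall fun ω => ?_)
        simp only [Measure.volumeIoiPow, ENNReal.ofReal, g]
        rw [integral_withDensity_eq_integral_smul,
          integral_subtype_comap measurableSet_Ioi
            fun a ↦ Real.toNNReal (a ^ (n - 1)) • f (a • ω.1),
          setIntegral_congr_fun measurableSet_Ioi fun x hx ↦ ?_]
        · rw [NNReal.smul_def, Real.coe_toNNReal _ (pow_nonneg hx.out.le _), smul_eq_mul]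
        · exact (measurable_subtype_coe.pow_const _).real_toNNReal

/-- A product of Lipschitz functions on a bounded set is Lipschitz. -/
theorem LipschitzOnWith.exists_mul_of_isBounded {X : Type*} [PseudoMetricSpace X] {s : Set X}
    (hs : Bornology.IsBounded s) {f g : X → ℝ} {K L : NNReal} (hf : LipschitzOnWith K f s)
    (hg : LipschitzOnWith L g s) : ∃ M : NNReal, LipschitzOnWith M (fun x => f x * g x) s := by
  have hbd : ∀ {φ : X → ℝ} {K : NNReal}, LipschitzOnWith K φ s → ∃ B : ℝ, ∀ x ∈ s, |φ x| ≤ B := by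
    intro φ K hφ
    rcases s.eq_empty_or_nonempty with rfl | ⟨x₀, hx₀⟩
    · exact ⟨0, by simp⟩
    refine ⟨|φ x₀| + K * Metric.diam s, fun x hx => ?_⟩
    have h1 := hφ.dist_le_mul x hx x₀ hx₀
    have h2 : K * dist x x₀ ≤ K * Metric.diam s := by
      gcongr; exact Metric.dist_le_diam_of_mem hs hx hx₀
    rw [Real.dist_eq] at h1
    have h3 := abs_sub_abs_le_abs_sub (φ x) (φ x₀)
    linarith
  obtain ⟨A, hA⟩ := hbd hf
  obtain ⟨B, hB⟩ := hbd hg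
  refine ⟨Real.toNNReal (|B| * K + |A| * L), LipschitzOnWith.of_dist_le_mul fun x hx y hy => ?_⟩
  rw [Real.coe_toNNReal _ (by positivity)]
  have h1 := hf.dist_le_mul x hx y hy
  have h2 := hg.dist_le_mul x hx y hy
  rw [Real.dist_eq] at *
  calc |f x * g x - f y * g y| = |(f x - f y) * g x + f y * (g x - g y)| := by ring_nf
    _ ≤ |f x - f y| * |g x| + |f y| * |g x - g y| := by
        rw [← abs_mul, ← abs_mul]; exact abs_add_le _ _
    _ ≤ (K * dist x y) * |B| + |A| * (L * dist x y) := by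
        have := (hB x hx).trans (le_abs_self _)
        have := (hA y hy).trans (le_abs_self _)
        exact add_le_add (mul_le_mul h1 ‹_› (abs_nonneg _) (by positivity))
          (mul_le_mul ‹_› h2 (abs_nonneg _) (abs_nonneg _))
    _ = _ := by ring

/-- The radial cutoff `((max a (min |x| b))⁻ⁿ⁻² - b⁻ⁿ⁻²) / (n + 2)`. -/
def radCut (n : ℕ) (a b : ℝ) (x : En n) : ℝ :=
  (((max a (min ‖x‖ b))⁻¹) ^ (n + 2) - (b⁻¹) ^ (n + 2)) / (n + 2)

theorem radCut_eq_zero {n : ℕ} {a b : ℝ} (hab : a ≤ b) {x : En n} (hx : b ≤ ‖x‖) :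
    radCut n a b x = 0 := by
  simp [radCut, hx, hab]

theorem hasCompactSupport_radCut {n : ℕ} {a b : ℝ} (hab : a ≤ b) :
    HasCompactSupport (radCut n a b) := by
  refine HasCompactSupport.of_support_subset_isCompact (isCompact_closedBall (0 : En n) b) ?_
  intro x hx
  rw [mem_closedBall_zero_iff]
  by_contra! h
  exact hx (radCut_eq_zero hab h.le)

theorem radCut_nonneg {n : ℕ} {a b : ℝ} (ha : 0 < a) (hab : a ≤ b) (x : En n) :
    0 ≤ radCut n a b x := by
  have h1 : 0 < max a (min ‖x‖ b) := lt_max_of_lt_left ha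
  have h2 : max a (min ‖x‖ b) ≤ b := max_le hab (min_le_right _ _)
  refine div_nonneg (sub_nonneg.2 ?_) (by positivity)
  have : 0 < b := ha.trans_le hab
  gcongr

theorem exists_lipschitzWith_radCut (n : ℕ) {a b : ℝ} (ha : 0 < a) (hab : a ≤ b) :
    ∃ K : NNReal, LipschitzWith K (radCut n a b) := by
  have h1 : LipschitzWith 1 (fun x : En n => max a (min ‖x‖ b)) :=
    (lipschitzWith_one_norm.min_const b).const_max a
  have h2 : ContDiffOn ℝ 1 (fun s : ℝ => ((s⁻¹) ^ (n + 2) - (b⁻¹) ^ (n + 2)) / (n + 2))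
      (Set.Icc a b) := by
    intro s hs
    have : s ≠ 0 := (ha.trans_le hs.1).ne'
    exact ((((contDiffAt_inv ℝ this).pow _).sub contDiffAt_const).div_const _).contDiffWithinAt
  obtain ⟨K, hK⟩ := h2.exists_lipschitzOnWith one_ne_zero (convex_Icc _ _) isCompact_Icc
  refine ⟨K * 1, ?_⟩
  rw [← lipschitzOnWith_univ]
  exact hK.comp h1.lipschitzOnWith fun x _ => ⟨le_max_left _ _, max_le hab (min_le_right _ _)⟩

theorem lineDeriv_radCut_ae {n : ℕ} {a b : ℝ} (ha : 0 < a) (hab : a ≤ b) (i : Fin n) :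
    ∀ᵐ x : En n, lineDeriv ℝ (radCut n a b) x (-EuclideanSpace.single i 1) =
      {x : En n | a < ‖x‖ ∧ ‖x‖ < b}.indicator (fun x => x i * (‖x‖⁻¹) ^ (n + 4)) x := by
  have hb : 0 < b := ha.trans_le hab
  have hS : ∀ r : ℝ, r ≠ 0 → ∀ᵐ x : En n, ‖x‖ ≠ r := by
    intro r hr
    have := Measure.addHaar_sphere_of_ne_zero (volume : Measure (En n)) 0 hr
    filter_upwards [measure_eq_zero_iff_ae_notMem.1 this] with x hx
    simpa using hx
  filter_upwards [hS a ha.ne', hS b hb.ne'] with x hxa hxb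
  rcases lt_or_gt_of_ne hxa with h | h
  · rw [Set.indicator_of_notMem (fun hx => hx.1.not_gt h)]
    have : radCut n a b =ᶠ[𝓝 x] fun _ => ((a⁻¹) ^ (n + 2) - (b⁻¹) ^ (n + 2)) / (n + 2) := by
      filter_upwards [(isOpen_lt continuous_norm continuous_const).mem_nhds h] with y hy
      have hy : ‖y‖ < a := hy
      rw [radCut, min_eq_left (hy.le.trans hab), max_eq_left hy.le]
    rw [this.lineDeriv_eq]
    exact ((hasFDerivAt_const _ x).hasLineDerivAt _).lineDeriv
  rcases lt_or_gt_of_ne hxb with h' | h'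
  · rw [Set.indicator_of_mem (show x ∈ {x : En n | a < ‖x‖ ∧ ‖x‖ < b} from ⟨h, h'⟩)]
    have : radCut n a b =ᶠ[𝓝 x]
        fun y => ((‖y‖⁻¹) ^ (n + 2) - (b⁻¹) ^ (n + 2)) / (n + 2) := by
      filter_upwards [(isOpen_lt continuous_const continuous_norm).mem_nhds h,
        (isOpen_lt continuous_norm continuous_const).mem_nhds h'] with y hy hy'
      have hy : a < ‖y‖ := hy
      have hy' : ‖y‖ < b := hy'
      rw [radCut, min_eq_left hy'.le, max_eq_right hy.le]
    rw [this.lineDeriv_eq]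
    have hx0 : ‖x‖ ≠ 0 := (ha.trans h).ne'
    have hx0' : x ≠ 0 := norm_ne_zero_iff.1 hx0
    have hnorm : HasFDerivAt (fun y : En n => ‖y‖) (‖x‖⁻¹ • innerSL ℝ x) x := by
      have h1 := (hasStrictFDerivAt_norm_sq x).hasFDerivAt.sqrt (by positivity)
      simp only [Real.sqrt_sq (norm_nonneg _)] at h1
      refine h1.congr_fderiv ?_
      ext v
      simp
      field_simp
    have hs : HasDerivAt (fun s : ℝ => ((s⁻¹) ^ (n + 2) - (b⁻¹) ^ (n + 2)) / (n + 2))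
        (-(‖x‖⁻¹) ^ (n + 3)) ‖x‖ := by
      have := ((((hasDerivAt_inv hx0).pow (n + 2)).sub_const ((b⁻¹) ^ (n + 2))).div_const
        ((n : ℝ) + 2))
      refine HasDerivAt.congr_deriv this ?_
      push_cast
      rw [mul_assoc, mul_div_cancel_left₀ _ (by positivity), ← inv_pow]
      ring
    have := (hs.comp_hasFDerivAt x hnorm).hasLineDerivAt (-EuclideanSpace.single i 1)
    refine this.lineDeriv.trans ?_
    have hi : inner ℝ x (EuclideanSpace.single i 1) = x i := by
      simp [EuclideanSpace.inner_single_right]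
    simp [innerSL_apply_apply, hi]
    ring
  · rw [Set.indicator_of_notMem (fun hx => hx.2.not_gt h')]
    have : radCut n a b =ᶠ[𝓝 x] fun _ => 0 := by
      filter_upwards [(isOpen_lt continuous_const continuous_norm).mem_nhds h'] with y hy
      exact radCut_eq_zero hab (le_of_lt hy)
    rw [this.lineDeriv_eq]
    exact ((hasFDerivAt_const _ x).hasLineDerivAt _).lineDeriv

/-- The gradient `A x` of the quadratic form `ψ_A`. -/
def gradPsi {n : ℕ} (A : Matrix (Fin n) (Fin n) ℝ) (x : En n) : En n :=
  WithLp.toLp 2 fun i => ∑ j, A i j * x j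

theorem gradPsi_apply {n : ℕ} (A : Matrix (Fin n) (Fin n) ℝ) (x : En n) (i : Fin n) :
    gradPsi A x i = ∑ j, A i j * x j := rfl

theorem hasFDerivAt_coord {n : ℕ} (i : Fin n) (x : En n) :
    HasFDerivAt (fun y : En n => y i) (EuclideanSpace.proj i : En n →L[ℝ] ℝ) x :=
  (EuclideanSpace.proj i : En n →L[ℝ] ℝ).hasFDerivAt

theorem inner_eq_sum {n : ℕ} (x y : En n) : inner ℝ x y = ∑ i, x i * y i := by
  rw [PiLp.inner_apply]
  exact Finset.sum_congr rfl fun i _ => by simp [mul_comm]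

theorem inner_gradPsi {n : ℕ} (A : Matrix (Fin n) (Fin n) ℝ) (x : En n) :
    ∑ i, x i * gradPsi A x i = 2 * psiM A x := by
  simp only [gradPsi_apply, psiM, Finset.mul_sum]
  exact Finset.sum_congr rfl fun i _ => Finset.sum_congr rfl fun j _ => by ring

theorem hasGradientAt_psiM {n : ℕ} {A : Matrix (Fin n) (Fin n) ℝ} (hA : A.IsSymm) (x : En n) :
    HasGradientAt (psiM A) (gradPsi A x) x := by
  rw [hasGradientAt_iff_hasFDerivAt]
  have h := (HasFDerivAt.fun_sum (u := Finset.univ) fun i _ =>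
    HasFDerivAt.fun_sum (u := Finset.univ) fun j _ =>
      ((hasFDerivAt_coord i x).const_mul (A i j)).mul (hasFDerivAt_coord j x)).const_mul (1 / 2 : ℝ)
  refine HasFDerivAt.congr_fderiv h ?_
  ext v
  have e : ∑ i, ∑ j, A i j * x i * v j = ∑ i, ∑ j, A i j * x j * v i := by
    rw [Finset.sum_comm]
    refine Finset.sum_congr rfl fun i _ => Finset.sum_congr rfl fun j _ => ?_
    rw [hA.apply]
  have e2 : ∑ i, ∑ j, x j * (A i j * v i) = ∑ i, ∑ j, A i j * x j * v i :=
    Finset.sum_congr rfl fun i _ => Finset.sum_congr rfl fun j _ => by ring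
  simp [Finset.sum_add_distrib, e, e2, inner_eq_sum, gradPsi_apply, Finset.sum_mul]
  ring

theorem hasGradientAt_p0 {n : ℕ} (x : En n) : HasGradientAt (p0 n) ((n : ℝ)⁻¹ • x) x := by
  rw [hasGradientAt_iff_hasFDerivAt]
  have h := (hasStrictFDerivAt_norm_sq x).hasFDerivAt.mul_const ((2 * (n : ℝ))⁻¹)
  refine HasFDerivAt.congr_fderiv (h.congr_of_eventuallyEq
    (.of_forall fun y => by simp [p0, div_eq_mul_inv])) ?_
  ext v
  simp
  ring

/-- `u - u(0) - p₀`, which has Laplacian `-χ_Λ`. -/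
def devU {n : ℕ} (u : En n → ℝ) (x : En n) : ℝ := u x - u 0 - p0 n x

/-- The gradient of `devU`. -/
def gradDev {n : ℕ} (u : En n → ℝ) (x : En n) : En n := gradient u x - (n : ℝ)⁻¹ • x

theorem hasGradientAt_devU {n : ℕ} {u : En n → ℝ} (hu : SolutionHyp u) {x : En n}
    (hx : x ∈ ball (0 : En n) 1) : HasGradientAt (devU u) (gradDev u x) x := by
  have h1 : HasFDerivAt u (InnerProductSpace.toDual ℝ _ (gradient u x)) x :=
    (hu.1 x hx).hasGradientAt.hasFDerivAt
  have h2 := (hasGradientAt_p0 x).hasFDerivAt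
  rw [hasGradientAt_iff_hasFDerivAt]
  refine HasFDerivAt.congr_fderiv ((h1.sub_const (u 0)).sub h2) ?_
  simp [gradDev]

theorem exists_lipschitzOnWith_gradDev {n : ℕ} {u : En n → ℝ} (hu : SolutionHyp u) (i : Fin n) :
    ∃ K : NNReal, LipschitzOnWith K (fun x => gradDev u x i) (ball (0 : En n) 1) := by
  obtain ⟨L, hL⟩ := hu.2.1
  have h1 := ((EuclideanSpace.proj i : En n →L[ℝ] ℝ).lipschitz).comp_lipschitzOnWith
    (hL.sub ((lipschitzWith_smul ((n : ℝ)⁻¹) : LipschitzWith _ fun x : En n => (n : ℝ)⁻¹ • x)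
      |>.lipschitzOnWith))
  exact ⟨_, h1⟩

theorem exists_lipschitzOnWith_devU {n : ℕ} {u : En n → ℝ} (hu : SolutionHyp u) :
    ∃ K : NNReal, LipschitzOnWith K (devU u) (ball (0 : En n) 1) := by
  obtain ⟨L, hL⟩ := hu.2.1
  refine ⟨L + ‖(n : ℝ)⁻¹‖₊, (convex_ball _ _).lipschitzOnWith_of_nnnorm_hasFDerivWithin_le
    (fun x hx => (hasGradientAt_devU hu hx).hasFDerivAt.hasFDerivWithinAt) fun x hx => ?_⟩
  have hx1 : ‖x‖ ≤ 1 := by simpa using (mem_ball.1 hx).le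
  have h1 : ‖gradient u x‖ ≤ L := by
    have := hL.dist_le_mul x hx 0 (by simp)
    rw [hu.2.2.2.2, dist_zero_right, dist_zero_right] at this
    nlinarith [L.2]
  rw [← NNReal.coe_le_coe]
  simp only [coe_nnnorm, LinearIsometryEquiv.norm_map, NNReal.coe_add, gradDev]
  refine (norm_sub_le _ _).trans (add_le_add h1 ?_)
  rw [norm_smul]
  nlinarith [norm_nonneg ((n : ℝ)⁻¹)]

theorem exists_lipschitzOnWith_ball_of_contDiff {n : ℕ} {f : En n → ℝ} (hf : ContDiff ℝ 1 f) :
    ∃ K : NNReal, LipschitzOnWith K f (ball (0 : En n) 1) := by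
  obtain ⟨K, hK⟩ := (hf.contDiffOn (s := closedBall (0 : En n) 1)).exists_lipschitzOnWith
    one_ne_zero (convex_closedBall _ _) (isCompact_closedBall _ _)
  exact ⟨K, hK.mono ball_subset_closedBall⟩

/-- The vector field `ψ_A ∇w - w ∇ψ_A` appearing in Green's formula, with `w = devU u`. -/
def greenField {n : ℕ} (u : En n → ℝ) (A : Matrix (Fin n) (Fin n) ℝ) (x : En n) (i : Fin n) : ℝ :=
  psiM A x * gradDev u x i - devU u x * gradPsi A x i

theorem exists_lipschitzOnWith_greenField {n : ℕ} {u : En n → ℝ} (hu : SolutionHyp u)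
    (A : Matrix (Fin n) (Fin n) ℝ) (i : Fin n) :
    ∃ K : NNReal, LipschitzOnWith K (fun x => greenField u A x i) (ball (0 : En n) 1) := by
  obtain ⟨K₁, h₁⟩ := exists_lipschitzOnWith_gradDev hu i
  obtain ⟨K₂, h₂⟩ := exists_lipschitzOnWith_devU hu
  obtain ⟨K₃, h₃⟩ := exists_lipschitzOnWith_ball_of_contDiff (f := psiM A)
    (by unfold psiM; fun_prop)
  obtain ⟨K₄, h₄⟩ := exists_lipschitzOnWith_ball_of_contDiff (f := fun x => gradPsi A x i)
    (by simp only [gradPsi_apply]; fun_prop)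
  obtain ⟨K₅, h₅⟩ := LipschitzOnWith.exists_mul_of_isBounded isBounded_ball h₃ h₁
  obtain ⟨K₆, h₆⟩ := LipschitzOnWith.exists_mul_of_isBounded isBounded_ball h₂ h₄
  exact ⟨_, h₅.sub h₆⟩

theorem hasFDerivAt_gradPsi_apply {n : ℕ} (A : Matrix (Fin n) (Fin n) ℝ) (i : Fin n) (x : En n) :
    HasFDerivAt (fun y => gradPsi A y i)
      (∑ j, A i j • (EuclideanSpace.proj j : En n →L[ℝ] ℝ)) x :=
  HasFDerivAt.fun_sum (u := Finset.univ) fun j _ => (hasFDerivAt_coord j x).const_mul (A i j)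

/-- The divergence of the Green field is `-χ_Λ ψ_A` almost everywhere. -/
theorem sum_lineDeriv_greenField_ae {n : ℕ} (hn : 2 ≤ n) {u : En n → ℝ} (hu : SolutionHyp u)
    {A : Matrix (Fin n) (Fin n) ℝ} (hA : S0 A) :
    ∀ᵐ x : En n, x ∈ ball (0 : En n) 1 →
      ∑ i, lineDeriv ℝ (fun y => greenField u A y i) x (EuclideanSpace.single i 1) =
        -(Lam u).indicator (psiM A) x := by
  have hae := (ae_restrict_iff' measurableSet_ball).1 hu.2.2.1
  filter_upwards [hae] with x hx hxb
  obtain ⟨D, hD, hD0, hD1⟩ := hx hxb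
  have htr : LinearMap.trace ℝ (En n) (D : En n →ₗ[ℝ] En n) =
      ∑ i, D (EuclideanSpace.single i 1) i := by
    rw [LinearMap.trace_eq_sum_inner _ (EuclideanSpace.basisFun (Fin n) ℝ)]
    simp [EuclideanSpace.inner_single_left]
  have hline : ∀ i, lineDeriv ℝ (fun y => greenField u A y i) x (EuclideanSpace.single i 1) =
      psiM A x * (D (EuclideanSpace.single i 1) i - (n : ℝ)⁻¹) - devU u x * A i i := by
    intro i
    have h1 := (hasGradientAt_psiM hA.1 x).hasFDerivAt
    have h2 := (hasGradientAt_devU hu hxb).hasFDerivAt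
    have h3 : HasFDerivAt (fun y => gradDev u y i) ((EuclideanSpace.proj i : En n →L[ℝ] ℝ).comp
        (D - (n : ℝ)⁻¹ • ContinuousLinearMap.id ℝ (En n))) x :=
      (EuclideanSpace.proj i : En n →L[ℝ] ℝ).hasFDerivAt.comp x
        (hD.sub ((hasFDerivAt_id x).const_smul ((n : ℝ)⁻¹)))
    have h4 := ((h1.mul h3).sub (h2.mul (hasFDerivAt_gradPsi_apply A i x))).hasLineDerivAt
      (EuclideanSpace.single i 1)
    refine h4.lineDeriv.trans ?_
    simp [EuclideanSpace.inner_single_right, PiLp.single_apply]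
    ring
  rw [Finset.sum_congr rfl fun i _ => hline i, Finset.sum_sub_distrib, ← Finset.mul_sum,
    ← Finset.mul_sum, Finset.sum_sub_distrib, ← htr]
  have htrA : ∑ i, A i i = 0 := hA.2
  have hn0 : (n : ℝ) ≠ 0 := by positivity
  rw [htrA]
  by_cases hg : gradient u x = 0
  · rw [Set.indicator_of_mem (show x ∈ Lam u from ⟨hxb, hg⟩), hD0 hg]
    simp [hn0]
  · rw [Set.indicator_of_notMem (fun h : x ∈ Lam u => hg h.2), hD1 hg]
    simp [hn0]

theorem norm_lt_one_of_le_radius {n : ℕ} {b : ℝ} (hb : b < 1) {x : En n} (hx : ‖x‖ ≤ b) :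
    x ∈ ball (0 : En n) 1 := by
  rw [mem_ball_zero_iff]; exact hx.trans_lt hb

theorem integrableOn_annulus_greenField_apply {n : ℕ} {u : En n → ℝ} (hu : SolutionHyp u)
    (A : Matrix (Fin n) (Fin n) ℝ) {a b : ℝ} (ha : 0 < a) (hb : b < 1) (i : Fin n) :
    IntegrableOn (fun x => (‖x‖⁻¹) ^ (n + 4) * (x i * greenField u A x i))
      {x : En n | a < ‖x‖ ∧ ‖x‖ < b} := by
  obtain ⟨K, hK⟩ := exists_lipschitzOnWith_greenField hu A i
  let S' : Set (En n) := closedBall 0 b \ ball 0 a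
  have hS' : IsCompact S' := (isCompact_closedBall _ _).diff isOpen_ball
  refine IntegrableOn.mono_set (ContinuousOn.integrableOn_compact (K := S') hS' ?_) ?_
  · refine ContinuousOn.mul ?_ (ContinuousOn.mul (by fun_prop) (hK.continuousOn.mono ?_))
    · refine ContinuousOn.pow (ContinuousOn.inv₀ (by fun_prop) fun x hx => ?_) _
      have : a ≤ ‖x‖ := by simpa using hx.2
      exact (ha.trans_le this).ne'
    · intro x hx
      exact norm_lt_one_of_le_radius hb (by simpa using hx.1)
  · intro x hx
    exact ⟨by simpa using hx.2.le, by simpa using hx.1.le⟩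

/-- Green's formula on balls, tested against the radial cutoff. -/
theorem integral_annulus_greenField {n : ℕ} (hn : 2 ≤ n) {u : En n → ℝ} (hu : SolutionHyp u)
    {A : Matrix (Fin n) (Fin n) ℝ} (hA : S0 A) {a b : ℝ} (ha : 0 < a) (hab : a ≤ b) (hb : b < 1) :
    ∫ x in {x : En n | a < ‖x‖ ∧ ‖x‖ < b}, (‖x‖⁻¹) ^ (n + 4) * ∑ i, x i * greenField u A x i =
      -∫ x, (Lam u).indicator (psiM A) x * radCut n a b x := by
  choose K hK using exists_lipschitzOnWith_greenField hu A
  choose g hgL hgE using fun i => (hK i).extend_real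
  obtain ⟨M, hM⟩ := exists_lipschitzWith_radCut n ha hab
  have hcs := hasCompactSupport_radCut (n := n) hab
  set S : Set (En n) := {x : En n | a < ‖x‖ ∧ ‖x‖ < b} with hSdef
  have hSm : MeasurableSet S := ((isOpen_lt continuous_const continuous_norm).inter
    (isOpen_lt continuous_norm continuous_const)).measurableSet
  have hibp : ∀ i, ∫ x, lineDeriv ℝ (g i) x (EuclideanSpace.single i 1) * radCut n a b x =
      ∫ x in S, (‖x‖⁻¹) ^ (n + 4) * (x i * greenField u A x i) := by
    intro i
    rw [(hgL i).integral_lineDeriv_mul_eq hM hcs, ← integral_indicator hSm]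
    refine integral_congr_ae ?_
    filter_upwards [lineDeriv_radCut_ae ha hab i] with x hx
    rw [hx]
    by_cases hxS : x ∈ S
    · rw [Set.indicator_of_mem hxS, Set.indicator_of_mem hxS,
        ← hgE i (norm_lt_one_of_le_radius hb hxS.2.le)]
      ring
    · rw [Set.indicator_of_notMem hxS, Set.indicator_of_notMem hxS, zero_mul]
  have hint1 : ∀ i, Integrable fun x =>
      lineDeriv ℝ (g i) x (EuclideanSpace.single i 1) * radCut n a b x := fun i =>
    ((hgL i).locallyIntegrable_lineDeriv _).integrable_smul_right_of_hasCompactSupport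
      hM.continuous hcs
  have hint2 : ∀ i, IntegrableOn (fun x => (‖x‖⁻¹) ^ (n + 4) * (x i * greenField u A x i)) S :=
    integrableOn_annulus_greenField_apply hu A ha hb
  calc _ = ∫ x in S, ∑ i, (‖x‖⁻¹) ^ (n + 4) * (x i * greenField u A x i) := by
        simp only [Finset.mul_sum]
    _ = ∑ i, ∫ x, lineDeriv ℝ (g i) x (EuclideanSpace.single i 1) * radCut n a b x := by
        rw [integral_finsetSum _ fun i _ => hint2 i]
        exact Finset.sum_congr rfl fun i _ => (hibp i).symm
    _ = _ := by
        rw [← integral_finsetSum _ fun i _ => hint1 i, ← integral_neg]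
        refine integral_congr_ae ?_
        filter_upwards [sum_lineDeriv_greenField_ae hn hu hA] with x hx
        rcases lt_or_ge ‖x‖ b with hxb | hxb
        · have hx1 := norm_lt_one_of_le_radius hb hxb.le
          rw [← Finset.sum_mul, ← neg_mul, ← hx hx1]
          congr 1
          refine Finset.sum_congr rfl fun i _ => ?_
          refine (EventuallyEq.lineDeriv_eq ?_).symm
          filter_upwards [isOpen_ball.mem_nhds hx1] with y hy using hgE i hy
        · simp [radCut_eq_zero hab hxb]

theorem integrableOn_annulus_greenField {n : ℕ} {u : En n → ℝ} (hu : SolutionHyp u)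
    (A : Matrix (Fin n) (Fin n) ℝ) {a b : ℝ} (ha : 0 < a) (hb : b < 1) :
    IntegrableOn (fun x => (‖x‖⁻¹) ^ (n + 4) * ∑ i, x i * greenField u A x i)
      {x : En n | a < ‖x‖ ∧ ‖x‖ < b} := by
  simp only [Finset.mul_sum]
  exact integrable_finsetSum _ fun i _ => integrableOn_annulus_greenField_apply hu A ha hb i

theorem sum_mul_greenField {n : ℕ} (u : En n → ℝ) (A : Matrix (Fin n) (Fin n) ℝ) (x : En n) :
    ∑ i, x i * greenField u A x i =
      psiM A x * (inner ℝ x (gradDev u x) - 2 * devU u x) := by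
  have h1 := inner_gradPsi A x
  calc _ = psiM A x * ∑ i, x i * gradDev u x i - devU u x * ∑ i, x i * gradPsi A x i := by
        rw [Finset.mul_sum, Finset.mul_sum, ← Finset.sum_sub_distrib]
        exact Finset.sum_congr rfl fun i _ => by rw [greenField]; ring
    _ = _ := by rw [h1, inner_eq_sum]; ring

theorem continuousOn_gradDev {n : ℕ} {u : En n → ℝ} (hu : SolutionHyp u) :
    ContinuousOn (gradDev u) (ball (0 : En n) 1) := by
  obtain ⟨L, hL⟩ := hu.2.1
  exact hL.continuousOn.sub (by fun_prop)

/-- The radial derivative of `ρ⁻² w(ρω)`, integrated. -/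
theorem integral_radial_devU {n : ℕ} {u : En n → ℝ} (hu : SolutionHyp u)
    {a b : ℝ} (ha : 0 < a) (hab : a ≤ b) (hb : b < 1) {ω : En n} (hω : ‖ω‖ = 1) :
    ∫ ρ in a..b, (ρ⁻¹ ^ 2 * inner ℝ (gradDev u (ρ • ω)) ω - 2 * ρ⁻¹ ^ 3 * devU u (ρ • ω)) =
      b⁻¹ ^ 2 * devU u (b • ω) - a⁻¹ ^ 2 * devU u (a • ω) := by
  have hmem : ∀ ρ ∈ Set.uIcc a b, 0 < ρ ∧ ρ • ω ∈ ball (0 : En n) 1 := by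
    intro ρ hρ
    rw [Set.uIcc_of_le hab] at hρ
    have h0 : 0 < ρ := ha.trans_le hρ.1
    refine ⟨h0, norm_lt_one_of_le_radius hb ?_⟩
    rw [norm_smul, hω, mul_one, Real.norm_eq_abs, abs_of_pos h0]
    exact hρ.2
  have hmaps : Set.MapsTo (fun ρ : ℝ => ρ • ω) (Set.uIcc a b) (ball (0 : En n) 1) :=
    fun ρ hρ => (hmem ρ hρ).2
  have hcdev : ContinuousOn (devU u) (ball (0 : En n) 1) := by
    obtain ⟨K, hK⟩ := exists_lipschitzOnWith_devU hu
    exact hK.continuousOn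
  have hinv : ContinuousOn (fun ρ : ℝ => ρ⁻¹) (Set.uIcc a b) :=
    continuousOn_id.inv₀ fun ρ hρ => (hmem ρ hρ).1.ne'
  have hsm : ContinuousOn (fun ρ : ℝ => ρ • ω) (Set.uIcc a b) := by fun_prop
  refine intervalIntegral.integral_eq_sub_of_hasDerivAt
    (f := fun ρ => ρ⁻¹ ^ 2 * devU u (ρ • ω)) (fun ρ hρ => ?_) ?_
  · have h1 := (hasGradientAt_devU hu (hmem ρ hρ).2).hasFDerivAt
    have h2 : HasDerivAt (fun ρ : ℝ => ρ • ω) ω ρ := by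
      simpa using (hasDerivAt_id ρ).smul_const ω
    have h3 := h1.comp_hasDerivAt ρ h2
    have h4 := ((hasDerivAt_inv (hmem ρ hρ).1.ne').pow 2).mul h3
    refine HasDerivAt.congr_deriv h4 ?_
    have := (hmem ρ hρ).1.ne'
    simp
    field_simp
    ring
  · refine ContinuousOn.intervalIntegrable (ContinuousOn.sub ?_ ?_)
    · exact (hinv.pow 2).mul (((continuousOn_gradDev hu).comp hsm hmaps).inner continuousOn_const)
    · exact (continuousOn_const.mul (hinv.pow 3)).mul (hcdev.comp hsm hmaps)

theorem ut_eq_devU {n : ℕ} (u : En n → ℝ) (t : ℝ) (x : En n) :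
    ut u t x = (Real.exp (-t))⁻¹ ^ 2 * devU u (Real.exp (-t) • x) + p0 n x := by
  have h : Real.exp (2 * t) = Real.exp t ^ 2 := by rw [← Real.exp_nat_mul]; norm_num
  have := Real.exp_pos t
  rw [ut, devU, p0, p0, norm_smul, Real.norm_eq_abs, abs_of_pos (Real.exp_pos _), h, Real.exp_neg,
    inv_inv]
  field_simp
  ring

/-- The change of the second-order spherical moments of `u_t` between two scales. -/
theorem integral_toSphere_psiM_mul_ut_sub {n : ℕ} (hn : 2 ≤ n) {u : En n → ℝ} (hu : SolutionHyp u)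
    {A : Matrix (Fin n) (Fin n) ℝ} (hA : S0 A) {t t' : ℝ} (ht : 0 < t) (htt : t ≤ t') :
    ∫ ω : sphere (0 : En n) 1, psiM A ω * (ut u t ω - ut u t' ω)
        ∂((volume : Measure (En n)).toSphere) =
      -∫ x, (Lam u).indicator (psiM A) x * radCut n (Real.exp (-t')) (Real.exp (-t)) x := by
  set a := Real.exp (-t')
  set b := Real.exp (-t)
  have ha : 0 < a := Real.exp_pos _
  have hab : a ≤ b := Real.exp_le_exp.2 (by linarith)
  have hb : b < 1 := Real.exp_lt_one_iff.2 (by linarith)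
  rw [← integral_annulus_greenField hn hu hA ha hab hb]
  have hSm : MeasurableSet {x : En n | a < ‖x‖ ∧ ‖x‖ < b} :=
    ((isOpen_lt continuous_const continuous_norm).inter
      (isOpen_lt continuous_norm continuous_const)).measurableSet
  rw [← integral_indicator hSm, integral_eq_integral_toSphere hn
    ((integrableOn_annulus_greenField hu A ha hb).integrable_indicator hSm)]
  refine integral_congr_ae (.of_forall fun ω => ?_)
  have hω : ‖ω.1‖ = 1 := by simp
  have hnorm : ∀ ρ : ℝ, 0 < ρ → ‖ρ • ω.1‖ = ρ := fun ρ hρ => by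
    rw [norm_smul, hω, mul_one, Real.norm_eq_abs, abs_of_pos hρ]
  have e1 : ∀ ρ ∈ Set.Ioi (0 : ℝ), ρ ^ (n - 1) * {x : En n | a < ‖x‖ ∧ ‖x‖ < b}.indicator
      (fun x => (‖x‖⁻¹) ^ (n + 4) * ∑ i, x i * greenField u A x i) (ρ • ω.1) =
      (Set.Ioo a b).indicator (fun ρ => psiM A ω.1 * (ρ⁻¹ ^ 2 * inner ℝ (gradDev u (ρ • ω.1)) ω.1
        - 2 * ρ⁻¹ ^ 3 * devU u (ρ • ω.1))) ρ := by
    intro ρ hρ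
    have hρ : 0 < ρ := hρ
    by_cases hm : ρ ∈ Set.Ioo a b
    · rw [Set.indicator_of_mem hm, Set.indicator_of_mem (by simpa [hnorm ρ hρ] using hm),
        sum_mul_greenField, psiM_smul_right, hnorm ρ hρ, inner_smul_left,
        real_inner_comm (gradDev u (ρ • ω.1)) ω.1]
      obtain ⟨m, rfl⟩ : ∃ m, n = m + 1 := ⟨n - 1, by omega⟩
      have : ρ ^ (m + 1 - 1) * ρ⁻¹ ^ (m + 1 + 4) = ρ⁻¹ ^ 5 := by
        rw [Nat.add_sub_cancel, show m + 1 + 4 = m + 5 by ring, pow_add, ← mul_assoc, ← mul_pow,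
          mul_inv_cancel₀ hρ.ne', one_pow, one_mul]
      rw [← mul_assoc, this]
      simp only [conj_trivial]
      field_simp
    · rw [Set.indicator_of_notMem hm, Set.indicator_of_notMem (by simpa [hnorm ρ hρ] using hm),
        mul_zero]
  simp only
  rw [setIntegral_congr_fun measurableSet_Ioi e1, setIntegral_indicator measurableSet_Ioo,
    Set.inter_eq_right.2 (show Set.Ioo a b ⊆ Set.Ioi 0 from fun ρ hρ => ha.trans hρ.1),
    ← integral_Ioc_eq_integral_Ioo, ← intervalIntegral.integral_of_le hab,
    intervalIntegral.integral_const_mul, integral_radial_devU hu ha hab hb hω, ut_eq_devU,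
    ut_eq_devU]
  ring

theorem measurableSet_Lam {n : ℕ} {u : En n → ℝ} (hu : SolutionHyp u) : MeasurableSet (Lam u) := by
  obtain ⟨L, hL⟩ := hu.2.1
  obtain ⟨s, hs, hs'⟩ := continuousOn_iff_isClosed.1 hL.continuousOn {0} isClosed_singleton
  have : Lam u = s ∩ ball 0 1 := by
    rw [← hs']; ext x; simp [Lam, and_comm]
  rw [this]
  exact hs.measurableSet.inter measurableSet_ball

theorem Fdef_eq {n : ℕ} (u : En n → ℝ) (τ : ℝ) :
    Fdef u τ = Real.exp ((n + 2) * τ) *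
      ∫ x in Lam u ∩ ball (0 : En n) (Real.exp (-τ)), ‖x‖ ^ 2 := by
  have hpos := Real.exp_pos τ
  have h := Measure.setIntegral_comp_smul_of_pos (volume : Measure (En n)) (fun x => ‖x‖ ^ 2)
    (Lam u ∩ ball (0 : En n) (Real.exp (-τ))) hpos
  rw [Set.smul_set_inter₀ hpos.ne', _root_.smul_ball hpos.ne', smul_zero, Real.norm_eq_abs,
    abs_of_pos hpos, ← Real.exp_add, add_neg_cancel, Real.exp_zero, finrank_euclideanSpace_fin] at h
  simp only [norm_smul, mul_pow, Real.norm_eq_abs, abs_of_pos hpos, integral_const_mul,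
    smul_eq_mul] at h
  have h2 : Real.exp ((n + 2) * τ) = Real.exp τ ^ n * Real.exp τ ^ 2 := by
    rw [← pow_add, ← Real.exp_nat_mul]; push_cast; ring_nf
  rw [h2, mul_assoc, h, ← mul_assoc, mul_inv_cancel₀ (by positivity), one_mul]
  rfl

/-- The radial cutoff as a superposition of indicators of balls. -/
theorem radCut_eq_integral {n : ℕ} {t t' : ℝ} (htt : t ≤ t') (x : En n) :
    radCut n (Real.exp (-t')) (Real.exp (-t)) x =
      ∫ τ in t..t', if ‖x‖ < Real.exp (-τ) then Real.exp ((n + 2) * τ) else 0 := by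
  have hn2 : (0 : ℝ) < (n : ℝ) + 2 := by positivity
  have hcomp : ∀ p q : ℝ, ∫ τ in p..q, Real.exp (((n : ℝ) + 2) * τ) =
      (Real.exp ((n + 2) * q) - Real.exp ((n + 2) * p)) / (n + 2) := by
    intro p q
    rw [intervalIntegral.integral_comp_mul_left (fun y => Real.exp y) hn2.ne', integral_exp,
      smul_eq_mul, inv_mul_eq_div]
  have hpow : ∀ τ : ℝ, ((Real.exp (-τ))⁻¹) ^ (n + 2) = Real.exp ((n + 2) * τ) := by
    intro τ
    rw [Real.exp_neg, inv_inv, ← Real.exp_nat_mul]; push_cast; ring_nf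
  have hab : Real.exp (-t') ≤ Real.exp (-t) := Real.exp_le_exp.2 (by linarith)
  rcases le_total (Real.exp (-t)) ‖x‖ with h | h
  · rw [radCut_eq_zero hab h, intervalIntegral.integral_congr (g := fun _ => 0)]
    · simp
    · intro τ hτ
      rw [Set.uIcc_of_le htt] at hτ
      have : Real.exp (-τ) ≤ Real.exp (-t) := Real.exp_le_exp.2 (by linarith [hτ.1])
      simp [not_lt.2 (this.trans h)]
  · obtain ⟨s, hs, hs', hclip⟩ : ∃ s, t ≤ s ∧ s ≤ t' ∧
        (max (Real.exp (-t')) (min ‖x‖ (Real.exp (-t))) = Real.exp (-s) ∧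
        (∀ τ ∈ Set.Ioo t s, ‖x‖ < Real.exp (-τ)) ∧
        ∀ τ ∈ Set.Ioo s t', ¬ ‖x‖ < Real.exp (-τ)) := by
      rcases le_total ‖x‖ (Real.exp (-t')) with h' | h'
      · refine ⟨t', htt, le_rfl, ?_, fun τ hτ => h'.trans_lt (Real.exp_lt_exp.2 ?_), by simp⟩
        · rw [min_eq_left h, max_eq_left h']
        · linarith [hτ.2]
      · have hx : 0 < ‖x‖ := (Real.exp_pos _).trans_le h'
        have hl : Real.exp (- -Real.log ‖x‖) = ‖x‖ := by rw [neg_neg, Real.exp_log hx]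
        refine ⟨-Real.log ‖x‖, ?_, ?_, ?_, fun τ hτ => ?_, fun τ hτ => ?_⟩
        · rw [← hl, Real.exp_le_exp] at h; linarith
        · rw [← hl, Real.exp_le_exp] at h'; linarith
        · rw [hl, min_eq_left h, max_eq_right h']
        · conv_lhs => rw [← hl]
          exact Real.exp_lt_exp.2 (by linarith [hτ.2])
        · conv => rw [← hl]
          rw [Real.exp_lt_exp]; linarith [hτ.1]
    have hI : ∀ p q : ℝ, IntervalIntegrable
        (fun τ => if ‖x‖ < Real.exp (-τ) then Real.exp (((n : ℝ) + 2) * τ) else 0) volume p q := by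
      intro p q
      have hm : MeasurableSet {τ : ℝ | ‖x‖ < Real.exp (-τ)} :=
        (isOpen_lt continuous_const (by fun_prop)).measurableSet
      have hc : Continuous fun τ : ℝ => Real.exp (((n : ℝ) + 2) * τ) := by fun_prop
      have h0 := hc.intervalIntegrable (μ := volume) p q
      exact ⟨h0.1.indicator hm, h0.2.indicator hm⟩
    rw [← intervalIntegral.integral_add_adjacent_intervals (hI t s) (hI s t'),
      intervalIntegral.integral_of_le hs, intervalIntegral.integral_of_le hs',
      integral_Ioc_eq_integral_Ioo, integral_Ioc_eq_integral_Ioo,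
      setIntegral_congr_fun measurableSet_Ioo (g := fun τ => Real.exp (((n : ℝ) + 2) * τ))
        (fun τ hτ => if_pos (hclip.2.1 τ hτ)),
      setIntegral_congr_fun measurableSet_Ioo (g := fun _ => (0 : ℝ))
        (fun τ hτ => if_neg (hclip.2.2 τ hτ)), ← integral_Ioc_eq_integral_Ioo,
      ← intervalIntegral.integral_of_le hs, hcomp, integral_zero, add_zero, radCut, hclip.1,
      hpow, hpow]

/-- The weighted second moment of `Λ` against the radial cutoff is the integral of `F`. -/
theorem integral_Lam_mul_radCut {n : ℕ} {u : En n → ℝ} (hu : SolutionHyp u) {t t' : ℝ}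
    (htt : t ≤ t') :
    ∫ x, (Lam u).indicator (fun x => ‖x‖ ^ 2) x * radCut n (Real.exp (-t')) (Real.exp (-t)) x =
      ∫ τ in t..t', Fdef u τ := by
  have hL := measurableSet_Lam hu
  let f : En n → ℝ → ℝ := fun x τ => (Lam u).indicator (fun x => ‖x‖ ^ 2) x *
    if ‖x‖ < Real.exp (-τ) then Real.exp ((n + 2) * τ) else 0
  have hfm : Measurable (Function.uncurry f) := by
    refine Measurable.mul ?_ ?_
    · exact (((by fun_prop : Measurable fun x : En n => ‖x‖ ^ 2).indicator hL)).comp measurable_fst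
    · exact Measurable.ite (measurableSet_lt (by fun_prop) (by fun_prop)) (by fun_prop)
        measurable_const
  have hLb : Lam u ⊆ ball 0 1 := fun x hx => hx.1
  have hfi : Integrable (Function.uncurry f)
      ((volume : Measure (En n)).prod (volume.restrict (Set.Ioc t t'))) := by
    have hbase : Integrable (fun p : En n × ℝ =>
        (ball (0 : En n) 1).indicator (fun _ => (1 : ℝ)) p.1 * Real.exp ((n + 2) * p.2))
        ((volume : Measure (En n)).prod (volume.restrict (Set.Ioc t t'))) := by
      refine Integrable.mul_prod (f := (ball (0 : En n) 1).indicator fun _ => (1 : ℝ))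
        (g := fun τ : ℝ => Real.exp (((n : ℝ) + 2) * τ)) ?_ ?_
      · exact (integrable_indicator_iff measurableSet_ball).2
          (integrableOn_const (by simp [measure_ball_lt_top.ne]))
      · exact ((by fun_prop : Continuous fun τ : ℝ =>
          Real.exp (((n : ℝ) + 2) * τ)).integrableOn_Icc).mono_set Set.Ioc_subset_Icc_self
    refine hbase.mono' hfm.aestronglyMeasurable (.of_forall fun p => ?_)
    simp only [Function.uncurry, f]
    by_cases hp : p.1 ∈ Lam u
    · have h1 : ‖p.1‖ < 1 := by simpa using hLb hp
      rw [Set.indicator_of_mem hp, Set.indicator_of_mem (hLb hp), norm_mul]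
      refine mul_le_mul ?_ ?_ (norm_nonneg _) zero_le_one
      · rw [Real.norm_eq_abs, abs_of_nonneg (by positivity)]
        exact pow_le_one₀ (norm_nonneg _) h1.le
      · split_ifs
        · rw [Real.norm_eq_abs, abs_of_pos (Real.exp_pos _)]
        · simp [Real.exp_nonneg]
    · rw [Set.indicator_of_notMem hp, zero_mul, norm_zero]
      exact mul_nonneg (Set.indicator_nonneg (fun _ _ => zero_le_one) _) (Real.exp_nonneg _)
  calc _ = ∫ x, ∫ τ in Set.Ioc t t', f x τ := by
        refine integral_congr_ae (.of_forall fun x => ?_)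
        simp only [f]
        rw [radCut_eq_integral htt, integral_const_mul, intervalIntegral.integral_of_le htt]
    _ = ∫ τ in Set.Ioc t t', ∫ x, f x τ := integral_integral_swap hfi
    _ = _ := by
        rw [intervalIntegral.integral_of_le htt]
        refine integral_congr_ae (.of_forall fun τ => ?_)
        simp only
        rw [Fdef_eq, ← integral_indicator (hL.inter measurableSet_ball), ← integral_const_mul]
        refine integral_congr_ae (.of_forall fun x => ?_)
        simp only [f, Set.indicator, Set.mem_inter_iff, mem_ball_zero_iff]
        by_cases h1 : x ∈ Lam u <;> by_cases h2 : ‖x‖ < Real.exp (-τ) <;> simp [h1, h2, mul_comm]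

theorem exp_neg_smul_mem_ball {n : ℕ} {t : ℝ} (ht : 0 < t) {x : En n} (hx : ‖x‖ ≤ 1) :
    Real.exp (-t) • x ∈ ball (0 : En n) 1 := by
  refine norm_lt_one_of_le_radius (Real.exp_lt_one_iff.2 (by linarith : -t < 0)) ?_
  rw [norm_smul, Real.norm_eq_abs, abs_of_pos (Real.exp_pos _)]
  exact mul_le_of_le_one_right (Real.exp_nonneg _) hx

theorem continuousOn_ut {n : ℕ} {u : En n → ℝ} (hu : SolutionHyp u) {t : ℝ} (ht : 0 < t) :
    ContinuousOn (ut u t) (sphere (0 : En n) 1) := by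
  have h : ContinuousOn u (ball (0 : En n) 1) :=
    fun x hx => (hu.1 x hx).continuousAt.continuousWithinAt
  have h2 : ContinuousOn (fun x : En n => u (Real.exp (-t) • x)) (sphere (0 : En n) 1) :=
    h.comp (by fun_prop) fun x hx => exp_neg_smul_mem_ball ht (by simpa using (mem_sphere.1 hx).le)
  exact continuousOn_const.mul (h2.sub continuousOn_const)

theorem continuous_p0 (n : ℕ) : Continuous (p0 n) := by
  unfold p0; fun_prop

theorem S0.sub {n : ℕ} {A B : Matrix (Fin n) (Fin n) ℝ} (hA : S0 A) (hB : S0 B) : S0 (A - B) :=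
  ⟨hA.1.sub hB.1, by rw [Matrix.trace_sub, hA.2, hB.2, sub_zero]⟩

/-- The projection identity tested against a matrix. -/
theorem BProp.integral_psiM_mul {n : ℕ} (hn : 2 ≤ n) {u : En n → ℝ} (hu : SolutionHyp u)
    {B : ℝ → Matrix (Fin n) (Fin n) ℝ} (hB : BProp u B) {t : ℝ} (ht : 0 < t)
    {C : Matrix (Fin n) (Fin n) ℝ} (hC : S0 C) :
    ∫ x, psiM (B t) x * psiM C x ∂(sphMeas n) =
      ∫ x, (ut u t x - p0 n x) * psiM C x ∂(sphMeas n) := by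
  have h := (hB t ht).2 C hC
  have h1 : Integrable (fun x => (ut u t x - p0 n x) * psiM C x) (sphMeas n) :=
    integrable_sphMeas hn (((continuousOn_ut hu ht).sub (continuous_p0 n).continuousOn).mul
      (continuous_psiM C).continuousOn)
  have h2 : Integrable (fun x => psiM (B t) x * psiM C x) (sphMeas n) :=
    integrable_sphMeas hn ((continuous_psiM (B t)).mul (continuous_psiM C)).continuousOn
  have h3 := integral_sub h1 h2
  simp only [← sub_mul] at h3
  rw [h] at h3
  linarith

theorem abs_integral_psiM_mul_radCut_le {n : ℕ} {u : En n → ℝ} (hu : SolutionHyp u)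
    (A : Matrix (Fin n) (Fin n) ℝ) {t t' : ℝ} (htt : t ≤ t') :
    |∫ x, (Lam u).indicator (psiM A) x * radCut n (Real.exp (-t')) (Real.exp (-t)) x| ≤
      1 / 2 * frob A * ∫ τ in t..t', Fdef u τ := by
  have hab : Real.exp (-t') ≤ Real.exp (-t) := Real.exp_le_exp.2 (by linarith)
  rw [← integral_Lam_mul_radCut hu htt, ← integral_const_mul, ← Real.norm_eq_abs]
  obtain ⟨M, hM⟩ := exists_lipschitzWith_radCut n (Real.exp_pos (-t')) hab
  have hi : Integrable fun x : En n => (Lam u).indicator (fun x => ‖x‖ ^ 2) x *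
      radCut n (Real.exp (-t')) (Real.exp (-t)) x := by
    have : Integrable fun x : En n => ‖x‖ ^ 2 * radCut n (Real.exp (-t')) (Real.exp (-t)) x :=
      ((by fun_prop : Continuous fun x : En n => ‖x‖ ^ 2).mul
        hM.continuous).integrable_of_hasCompactSupport (hasCompactSupport_radCut hab).mul_left
    refine (this.indicator (measurableSet_Lam hu)).congr (.of_forall fun x => ?_)
    by_cases hx : x ∈ Lam u <;> simp [hx]
  refine norm_integral_le_of_norm_le (hi.const_mul _) (.of_forall fun x => ?_)
  have hr := radCut_nonneg (Real.exp_pos (-t')) hab x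
  by_cases hx : x ∈ Lam u
  · have := abs_psiM_le A x
    simp only [hx, Set.indicator_of_mem, norm_mul, Real.norm_eq_abs, abs_of_nonneg hr]
    nlinarith
  · simp [hx]

theorem integral_psiM_sub_mul {n : ℕ} (hn : 2 ≤ n) (A A' C : Matrix (Fin n) (Fin n) ℝ) :
    ∫ x, psiM (A - A') x * psiM C x ∂(sphMeas n) =
      ∫ x, psiM A x * psiM C x ∂(sphMeas n) - ∫ x, psiM A' x * psiM C x ∂(sphMeas n) := by
  rw [← integral_sub]
  · exact integral_congr_ae (.of_forall fun x => by simp only [psiM_sub]; ring)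
  · exact integrable_sphMeas hn ((continuous_psiM A).mul (continuous_psiM C)).continuousOn
  · exact integrable_sphMeas hn ((continuous_psiM A').mul (continuous_psiM C)).continuousOn

/-- The projection coefficients move at a rate controlled by the second moment of `Λ_t`. -/
theorem exists_frob_sub_le (n : ℕ) (hn : 2 ≤ n) :
    ∃ K : ℝ, 0 ≤ K ∧ ∀ u : En n → ℝ, SolutionHyp u →
      ∀ B : ℝ → Matrix (Fin n) (Fin n) ℝ, BProp u B → ∀ t t', 0 < t → t ≤ t' →
        frob (B t' - B t) ≤ K * ∫ τ in t..t', Fdef u τ := by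
  obtain ⟨κ, hκ, hintegral⟩ := exists_integral_sphMeas_eq n hn
  obtain ⟨c, hc, hfrob⟩ := exists_frob_sq_le_integral n hn
  refine ⟨κ / (2 * c), by positivity, fun u hu B hB t t' ht htt => ?_⟩
  have ht' : 0 < t' := ht.trans_le htt
  set C := B t' - B t with hCdef
  have hC : S0 C := (hB t' ht').1.sub (hB t ht).1
  have h1 : ∫ x, psiM C x ^ 2 ∂(sphMeas n) =
      κ * ∫ x, (Lam u).indicator (psiM C) x * radCut n (Real.exp (-t')) (Real.exp (-t)) x := by
    have hcont : ContinuousOn (fun x => psiM C x * (ut u t x - ut u t' x)) (sphere (0 : En n) 1) :=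
      (continuous_psiM C).continuousOn.mul ((continuousOn_ut hu ht).sub (continuousOn_ut hu ht'))
    have h3 := hintegral _ hcont
    rw [integral_toSphere_psiM_mul_ut_sub hn hu hC ht htt] at h3
    have hi : ∀ s, 0 < s → Integrable (fun x => (ut u s x - p0 n x) * psiM C x) (sphMeas n) :=
      fun s hs => integrable_sphMeas hn
        (((continuousOn_ut hu hs).sub (continuous_p0 n).continuousOn).mul
          (continuous_psiM C).continuousOn)
    calc ∫ x, psiM C x ^ 2 ∂(sphMeas n)
        = ∫ x, psiM (B t' - B t) x * psiM C x ∂(sphMeas n) := by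
          simp only [← hCdef, sq]
      _ = -∫ x, psiM C x * (ut u t x - ut u t' x) ∂(sphMeas n) := by
          rw [integral_psiM_sub_mul hn, hB.integral_psiM_mul hn hu ht' hC,
            hB.integral_psiM_mul hn hu ht hC, ← integral_sub (hi t' ht') (hi t ht), ← integral_neg]
          exact integral_congr_ae (.of_forall fun x => by ring)
      _ = _ := by rw [h3]; ring
  have h2 := hfrob C hC.1
  have h3 := (le_abs_self _).trans (abs_integral_psiM_mul_radCut_le hu C htt)
  have h4 : c * frob C ^ 2 ≤ κ * (1 / 2 * frob C * ∫ τ in t..t', Fdef u τ) :=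
    h2.trans (h1.le.trans (mul_le_mul_of_nonneg_left h3 hκ.le))
  have hF : 0 ≤ ∫ τ in t..t', Fdef u τ :=
    intervalIntegral.integral_nonneg htt fun τ _ => integral_nonneg fun x => by positivity
  rcases (frob_nonneg C).eq_or_lt with h0 | h0
  · rw [← h0]; positivity
  · rw [div_mul_eq_mul_div, le_div_iff₀ (by positivity)]
    have : frob C * (frob C * (2 * c)) ≤ frob C * (κ * ∫ τ in t..t', Fdef u τ) := by nlinarith
    exact le_of_mul_le_mul_left this h0

theorem hasGradientAt_Rt {n : ℕ} {u : En n → ℝ} (hu : SolutionHyp u)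
    {B : ℝ → Matrix (Fin n) (Fin n) ℝ} {t : ℝ} (ht : 0 < t) (hB : (B t).IsSymm) {x : En n}
    (hx : ‖x‖ ≤ 1) :
    HasGradientAt (Rt u B t)
      (Real.exp t • gradient u (Real.exp (-t) • x) - ((n : ℝ)⁻¹ • x + gradPsi (B t) x)) x := by
  have h1 : HasFDerivAt u (InnerProductSpace.toDual ℝ _ (gradient u (Real.exp (-t) • x)))
      (Real.exp (-t) • x) :=
    (hu.1 _ (exp_neg_smul_mem_ball ht hx)).hasGradientAt.hasFDerivAt
  have h2 : HasFDerivAt (fun y : En n => Real.exp (-t) • y)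
      (Real.exp (-t) • ContinuousLinearMap.id ℝ (En n)) x :=
    (Real.exp (-t) • ContinuousLinearMap.id ℝ (En n)).hasFDerivAt
  have h3 := ((h1.comp x h2).sub_const (u 0)).const_mul (Real.exp (2 * t))
  have h4 := (hasGradientAt_p0 x).hasFDerivAt.add (hasGradientAt_psiM hB x).hasFDerivAt
  rw [hasGradientAt_iff_hasFDerivAt]
  refine HasFDerivAt.congr_fderiv (h3.sub h4) ?_
  ext v
  have he : Real.exp (2 * t) * Real.exp (-t) = Real.exp t := by
    rw [← Real.exp_add]; congr 1; ring
  simp only [_root_.sub_apply, _root_.smul_apply,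
    ContinuousLinearMap.comp_apply, _root_.add_apply, map_sub, map_add, map_smul,
    InnerProductSpace.toDual_apply_apply, ContinuousLinearMap.id_apply, smul_eq_mul,
    ← he]
  ring

theorem norm_gradient_le {n : ℕ} {u : En n → ℝ} (hu : SolutionHyp u) {L : NNReal}
    (hL : LipschitzOnWith L (fun x => gradient u x) (ball (0 : En n) 1)) {x : En n}
    (hx : x ∈ ball (0 : En n) 1) : ‖gradient u x‖ ≤ L * ‖x‖ := by
  have h := hL.dist_le_mul x hx 0 (mem_ball_self one_pos)
  simpa [hu.2.2.2.2] using h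

theorem abs_ut_le {n : ℕ} {u : En n → ℝ} (hu : SolutionHyp u) {L : NNReal}
    (hL : LipschitzOnWith L (fun x => gradient u x) (ball (0 : En n) 1)) {t : ℝ} (ht : 0 < t)
    {x : En n} (hx : ‖x‖ ≤ 1) : |ut u t x| ≤ L := by
  set y := Real.exp (-t) • x with hy
  have hyb : y ∈ ball (0 : En n) 1 := exp_neg_smul_mem_ball ht hx
  have hsub : ∀ z ∈ closedBall (0 : En n) ‖y‖, z ∈ ball (0 : En n) 1 := fun z hz =>
    norm_lt_one_of_le_radius (by simpa using hyb) (by simpa using hz)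
  have h := (convex_closedBall (0 : En n) ‖y‖).norm_image_sub_le_of_norm_hasFDerivWithin_le
    (f := u) (C := L * ‖y‖)
    (fun z hz => (hu.1 z (hsub z hz)).hasGradientAt.hasFDerivAt.hasFDerivWithinAt)
    (fun z hz => by
      rw [LinearIsometryEquiv.norm_map]
      refine (norm_gradient_le hu hL (hsub z hz)).trans ?_
      gcongr
      simpa using hz)
    (mem_closedBall_self (norm_nonneg y)) (show y ∈ closedBall (0 : En n) ‖y‖ by simp)
  have hny : ‖y‖ ≤ Real.exp (-t) := by
    rw [hy, norm_smul, Real.norm_eq_abs, abs_of_pos (Real.exp_pos _)]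
    exact mul_le_of_le_one_right (Real.exp_nonneg _) hx
  rw [sub_zero, Real.norm_eq_abs] at h
  rw [ut, abs_mul, abs_of_pos (Real.exp_pos _)]
  calc Real.exp (2 * t) * |u y - u 0| ≤ Real.exp (2 * t) * (L * ‖y‖ * ‖y‖) := by gcongr
    _ ≤ Real.exp (2 * t) * (L * Real.exp (-t) * Real.exp (-t)) := by gcongr
    _ = L * (Real.exp (2 * t) * Real.exp (-t) * Real.exp (-t)) := by ring
    _ = L := by
      rw [← Real.exp_add, ← Real.exp_add, show 2 * t + -t + -t = 0 by ring, Real.exp_zero, mul_one]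

theorem norm_gradPsi_le {n : ℕ} (A : Matrix (Fin n) (Fin n) ℝ) (x : En n) :
    ‖gradPsi A x‖ ≤ frob A * ‖x‖ := by
  refine le_of_sq_le_sq ?_ (mul_nonneg (frob_nonneg A) (norm_nonneg x))
  rw [mul_pow, frob_sq, EuclideanSpace.real_norm_sq_eq, EuclideanSpace.real_norm_sq_eq,
    Finset.sum_mul]
  exact Finset.sum_le_sum fun i _ => by
    rw [gradPsi_apply]; exact Finset.sum_mul_sq_le_sq_mul_sq _ _ _

/-- The projection coefficients are bounded. -/
theorem BProp.exists_frob_le {n : ℕ} (hn : 2 ≤ n) {u : En n → ℝ} (hu : SolutionHyp u)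
    {B : ℝ → Matrix (Fin n) (Fin n) ℝ} (hB : BProp u B) :
    ∃ M : ℝ, 0 ≤ M ∧ ∀ t, 0 < t → frob (B t) ≤ M := by
  obtain ⟨c, hc, hfrob⟩ := exists_frob_sq_le_integral n hn
  obtain ⟨L, hL⟩ := hu.2.1
  set m := (sphMeas n).real Set.univ
  refine ⟨(L + 1) * m / c, by positivity, fun t ht => ?_⟩
  have hS := (hB t ht).1
  have h1 := hfrob (B t) hS.1
  have h2 := hB.integral_psiM_mul hn hu ht hS
  simp only [← sq] at h2
  have : Fact (2 ≤ n) := ⟨hn⟩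
  have hae : ∀ᵐ x ∂(sphMeas n), ‖(ut u t x - p0 n x) * psiM (B t) x‖ ≤ (L + 1) * frob (B t) := by
    refine (ae_restrict_iff' isClosed_sphere.measurableSet).2 (.of_forall fun x hx => ?_)
    have hx1 : ‖x‖ = 1 := by simpa using hx
    have hp : |p0 n x| ≤ 1 := by
      have hn' : (2 : ℝ) ≤ n := by exact_mod_cast hn
      rw [p0, hx1, abs_of_nonneg (by positivity), div_le_one (by positivity)]
      linarith
    have hψ := abs_psiM_le (B t) x
    rw [hx1] at hψ
    have hf := frob_nonneg (B t)
    rw [norm_mul, Real.norm_eq_abs, Real.norm_eq_abs]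
    refine mul_le_mul ?_ (by linarith) (abs_nonneg _) (by positivity)
    exact (abs_sub _ _).trans (add_le_add (abs_ut_le hu hL ht hx1.le) hp)
  have h3 := norm_integral_le_of_norm_le_const hae
  rw [← h2] at h3
  have h4 := h1.trans ((le_abs_self _).trans h3)
  rw [le_div_iff₀ hc]
  rcases (frob_nonneg (B t)).eq_or_lt with h0 | h0
  · rw [← h0, zero_mul]; positivity
  · refine le_of_mul_le_mul_left ?_ h0
    calc frob (B t) * (frob (B t) * c) = c * frob (B t) ^ 2 := by ring
      _ ≤ _ := h4
      _ = _ := by ring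

theorem exists_norm_gradient_Rt_le {n : ℕ} (hn : 2 ≤ n) {u : En n → ℝ} (hu : SolutionHyp u)
    {B : ℝ → Matrix (Fin n) (Fin n) ℝ} (hB : BProp u B) :
    ∃ M : ℝ, 0 ≤ M ∧ ∀ t, 0 < t → ∀ x : En n, ‖x‖ ≤ 1 → ‖gradient (Rt u B t) x‖ ≤ M := by
  obtain ⟨L, hL⟩ := hu.2.1
  obtain ⟨M, hM0, hM⟩ := hB.exists_frob_le hn hu
  refine ⟨L + (1 + M), by positivity, fun t ht x hx => ?_⟩
  rw [(hasGradientAt_Rt hu ht (hB t ht).1.1 hx).gradient]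
  refine (norm_sub_le _ _).trans (add_le_add ?_ ((norm_add_le _ _).trans (add_le_add ?_ ?_)))
  · have h := norm_gradient_le hu hL (exp_neg_smul_mem_ball ht hx)
    rw [norm_smul, Real.norm_eq_abs, abs_of_pos (Real.exp_pos _)] at h ⊢
    calc Real.exp t * ‖gradient u (Real.exp (-t) • x)‖
        ≤ Real.exp t * (L * (Real.exp (-t) * ‖x‖)) := by gcongr
      _ = L * ‖x‖ * (Real.exp t * Real.exp (-t)) := by ring
      _ = L * ‖x‖ := by rw [← Real.exp_add, add_neg_cancel, Real.exp_zero, mul_one]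
      _ ≤ L := mul_le_of_le_one_right L.2 hx
  · have hn' : (1 : ℝ) ≤ n := by exact_mod_cast (by omega : 1 ≤ n)
    rw [norm_smul, norm_inv, Real.norm_natCast]
    exact mul_le_one₀ (inv_le_one_of_one_le₀ hn') (norm_nonneg _) hx
  · exact (norm_gradPsi_le _ _).trans
      ((mul_le_of_le_one_right (frob_nonneg _) hx).trans (hM t ht))

theorem Real.biSup_le_of_nonneg {ι : Type*} {s : Set ι} {f : ι → ℝ} {M : ℝ} (hM : 0 ≤ M)
    (h : ∀ x ∈ s, f x ≤ M) : ⨆ x ∈ s, f x ≤ M :=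
  Real.iSup_le (fun x => Real.iSup_le (h x) hM) hM

theorem Real.le_biSup_of_bounded {ι : Type*} {s : Set ι} {f : ι → ℝ} {M : ℝ} (hM : 0 ≤ M)
    (h : ∀ x ∈ s, f x ≤ M) {x : ι} (hx : x ∈ s) : f x ≤ ⨆ x ∈ s, f x := by
  have hb : BddAbove (Set.range fun x => ⨆ _ : x ∈ s, f x) :=
    ⟨M, by rintro _ ⟨y, rfl⟩; exact Real.iSup_le (h y) hM⟩
  have := le_ciSup hb x
  rwa [ciSup_pos hx] at this

theorem norm_gradient_Rt_le_iSup_epsd {n : ℕ} (hn : 2 ≤ n) {u : En n → ℝ} (hu : SolutionHyp u)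
    {B : ℝ → Matrix (Fin n) (Fin n) ℝ} (hB : BProp u B) {T : ℝ} (hT : 0 < T) {s : ℝ} (hs : T ≤ s)
    {y : En n} (hy : 1 / 2 ≤ ‖y‖) (hy' : ‖y‖ ≤ 1) :
    ‖gradient (Rt u B s) y‖ ≤ ⨆ s ∈ Set.Ici T, epsd u B s := by
  obtain ⟨M, hM0, hM⟩ := exists_norm_gradient_Rt_le hn hu hB
  have h1 : ∀ s, T ≤ s → ∀ x ∈ {x : En n | 1 / 2 ≤ ‖x‖ ∧ ‖x‖ ≤ 1},
      ‖gradient (Rt u B s) x‖ ≤ M := fun s hs x hx => hM s (hT.trans_le hs) x hx.2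
  have h2 : ‖gradient (Rt u B s) y‖ ≤ epsd u B s :=
    Real.le_biSup_of_bounded (f := fun x => ‖gradient (Rt u B s) x‖) hM0 (h1 s hs) ⟨hy, hy'⟩
  exact h2.trans (Real.le_biSup_of_bounded (f := epsd u B) hM0
    (fun s hs => Real.biSup_le_of_nonneg hM0 (h1 s hs)) (Set.mem_Ici.2 hs))

theorem mem_LamT_iff {n : ℕ} {u : En n → ℝ} {t : ℝ} {x : En n} :
    x ∈ LamT u t ↔ Real.exp (-t) • x ∈ Lam u := by
  rw [LamT, Set.mem_smul_set_iff_inv_smul_mem₀ (Real.exp_pos t).ne', Real.exp_neg]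

/-- On the coincidence set the radial derivative of `R_t` is that of `-q_{B(t)}`. -/
theorem sum_mul_gradient_Rt {n : ℕ} {u : En n → ℝ} (hu : SolutionHyp u)
    {B : ℝ → Matrix (Fin n) (Fin n) ℝ} {t : ℝ} (ht : 0 < t) (hB : (B t).IsSymm) {x : En n}
    (hx : ‖x‖ ≤ 1) (hxL : x ∈ LamT u t) :
    ∑ i, x i * gradient (Rt u B t) x i = -((n : ℝ)⁻¹ * ‖x‖ ^ 2 + 2 * psiM (B t) x) := by
  rw [(hasGradientAt_Rt hu ht hB hx).gradient, (mem_LamT_iff.1 hxL).2, ← inner_eq_sum, smul_zero,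
    zero_sub, inner_neg_right, inner_add_right, inner_smul_right, real_inner_self_eq_norm_sq,
    inner_eq_sum x (gradPsi _ _), inner_gradPsi]

/-- Comparison of the radial derivative at a point with the one at the scale where the rescaled
point lies in the unit annulus. -/
theorem abs_radial_Rt_le {n : ℕ} (hn : 2 ≤ n) {u : En n → ℝ} (hu : SolutionHyp u)
    {B : ℝ → Matrix (Fin n) (Fin n) ℝ} (hB : BProp u B) {T t t' : ℝ} (hT : 0 < T) (ht : T ≤ t)
    (htt : t ≤ t') {x : En n} (hxL : x ∈ LamT u t) (hx : 1 / 2 ≤ ‖Real.exp (t' - t) • x‖)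
    (hx' : ‖Real.exp (t' - t) • x‖ ≤ 1) :
    |-((n : ℝ)⁻¹ * ‖x‖ ^ 2 + 2 * psiM (B t) x)| ≤
      (2 * (⨆ s ∈ Set.Ici T, epsd u B s) + frob (B t' - B t)) * ‖x‖ ^ 2 := by
  set η := ⨆ s ∈ Set.Ici T, epsd u B s
  set r := Real.exp (t' - t) with hr
  set y := r • x with hy
  have hr0 : 0 < r := Real.exp_pos _
  have hyL : y ∈ LamT u t' := by
    rw [mem_LamT_iff, hy, hr, smul_smul, ← Real.exp_add, show -t' + (t' - t) = -t by ring]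
    exact mem_LamT_iff.1 hxL
  have ht' : 0 < t' := hT.trans_le (ht.trans htt)
  have h1 := sum_mul_gradient_Rt hu ht' (hB t' ht').1.1 hx' hyL
  have h2 := norm_gradient_Rt_le_iSup_epsd hn hu hB hT (ht.trans htt) hx hx'
  have h3 : |inner ℝ y (gradient (Rt u B t') y)| ≤ r ^ 2 * (2 * η * ‖x‖ ^ 2) := by
    have hη : 0 ≤ η := (norm_nonneg _).trans h2
    calc |inner ℝ y (gradient (Rt u B t') y)| ≤ ‖y‖ * ‖gradient (Rt u B t') y‖ :=
          abs_real_inner_le_norm _ _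
      _ ≤ ‖y‖ * η := by gcongr
      _ ≤ 2 * η * ‖y‖ ^ 2 := by nlinarith [mul_nonneg hη (norm_nonneg y)]
      _ = _ := by rw [hy, norm_smul, Real.norm_eq_abs, abs_of_pos hr0]; ring
  rw [inner_eq_sum, h1, hy, psiM_smul_right, norm_smul, Real.norm_eq_abs, abs_of_pos hr0,
    show -((n : ℝ)⁻¹ * (r * ‖x‖) ^ 2 + 2 * (r ^ 2 * psiM (B t') x)) =
      r ^ 2 * -((n : ℝ)⁻¹ * ‖x‖ ^ 2 + 2 * psiM (B t') x) by ring, abs_mul,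
    abs_of_pos (by positivity : 0 < r ^ 2)] at h3
  have h4 := le_of_mul_le_mul_left h3 (by positivity)
  have h5 := abs_psiM_le (B t' - B t) x
  rw [psiM_sub] at h5
  rw [abs_le] at h4 h5 ⊢
  constructor <;> nlinarith

theorem measurableSet_LamT {n : ℕ} {u : En n → ℝ} (hu : SolutionHyp u) (t : ℝ) :
    MeasurableSet (LamT u t) :=
  (measurableSet_Lam hu).const_smul₀ _

theorem isOpen_annK (n k : ℕ) : IsOpen (annK n k) :=
  (isOpen_lt continuous_const continuous_norm).inter (isOpen_lt continuous_norm continuous_const)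

theorem exp_nat_mul_log_two (k : ℕ) : Real.exp (k * Real.log 2) = 2 ^ k := by
  rw [Real.exp_nat_mul, Real.exp_log two_pos]

theorem mem_annK_iff {n k : ℕ} {x : En n} : x ∈ annK n k ↔ (2 : ℝ) ^ k • x ∈ ann0 n := by
  have h2 : (0 : ℝ) < 2 ^ k := by positivity
  have e1 : (2 : ℝ) ^ (-(k : ℤ)) = (2 ^ k)⁻¹ := by rw [zpow_neg, zpow_natCast]
  have e2 : (2 : ℝ) ^ (-(k : ℤ) - 1) = (2 ^ k)⁻¹ * (1 / 2) := by
    rw [zpow_sub₀ two_ne_zero, e1, zpow_one]; ring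
  simp only [annK, ann0, Set.mem_ofPred_eq, norm_smul, norm_pow, Real.norm_ofNat, e1, e2]
  rw [inv_mul_lt_iff₀ h2, ← one_div, lt_div_iff₀' h2]

theorem annK_subset_ball (n k : ℕ) : annK n k ⊆ ball (0 : En n) 1 := fun x hx => by
  rw [mem_ball_zero_iff]
  exact hx.2.trans_le (zpow_le_one_of_nonpos₀ one_le_two (by simp))

theorem pairwise_disjoint_annK (n : ℕ) : Pairwise (Function.onFun Disjoint (annK n)) := by
  have key : ∀ i j : ℕ, i < j → Disjoint (annK n i) (annK n j) := by
    intro i j hij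
    refine Set.disjoint_left.2 fun x hi hj => ?_
    have h : (2 : ℝ) ^ (-(j : ℤ)) ≤ 2 ^ (-(i : ℤ) - 1) :=
      zpow_le_zpow_right₀ one_le_two (by omega)
    linarith [hi.1, hj.2]
  intro i j hij
  rcases hij.lt_or_gt with h | h
  · exact key i j h
  · exact (key j i h).symm

/-- Up to a null set the unit ball is the union of the dyadic annuli. -/
theorem ball_ae_eq_iUnion_annK {n : ℕ} (hn : 2 ≤ n) :
    (ball (0 : En n) 1 : Set (En n)) =ᵐ[volume] ⋃ k, annK n k := by
  have : Nontrivial (En n) := by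
    have : Nonempty (Fin n) := ⟨⟨0, by omega⟩⟩
    infer_instance
  have hnull : ∀ᵐ x : En n, x ≠ 0 ∧ ∀ k : ℕ, x ∉ sphere (0 : En n) ((1 / 2) ^ k) :=
    (Measure.ae_ne volume 0).and (ae_all_iff.2 fun k => measure_eq_zero_iff_ae_notMem.1
      (Measure.addHaar_sphere volume 0 _))
  filter_upwards [hnull] with x hx
  refine propext ⟨fun hb => ?_, fun hU => ?_⟩
  · have hb1 : ‖x‖ < 1 := by simpa using (show x ∈ ball (0 : En n) 1 from hb)
    obtain ⟨k, hk, hk'⟩ := exists_nat_pow_near_of_lt_one (norm_pos_iff.2 hx.1) hb1.le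
      (by norm_num : (0 : ℝ) < 1 / 2) (by norm_num)
    have hne : ‖x‖ ≠ (1 / 2) ^ k := by simpa using hx.2 k
    refine Set.mem_iUnion.2 ⟨k, ?_, ?_⟩
    · rwa [show -(k : ℤ) - 1 = -((k + 1 : ℕ) : ℤ) by push_cast; ring, zpow_neg, zpow_natCast,
        ← inv_pow, ← one_div]
    · rw [zpow_neg, zpow_natCast, ← inv_pow, ← one_div]
      exact lt_of_le_of_ne hk' hne
  · obtain ⟨k, hk⟩ := Set.mem_iUnion.1 (show x ∈ ⋃ k, annK n k from hU)
    exact annK_subset_ball n k hk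

/-- Dyadic decomposition of an integral over `Λ_t ∩ B₁`. -/
theorem hasSum_integral_annK {n : ℕ} (hn : 2 ≤ n) {u : En n → ℝ} (hu : SolutionHyp u) (t : ℝ)
    {f : En n → ℝ} (hf : Continuous f) :
    HasSum (fun k => ∫ x in LamT u t ∩ annK n k, f x) (∫ x in LamT u t ∩ ball (0 : En n) 1, f x) := by
  have hL := measurableSet_LamT hu t
  have hae : (LamT u t ∩ ball (0 : En n) 1 : Set (En n)) =ᵐ[volume] ⋃ k, LamT u t ∩ annK n k := by
    rw [← Set.inter_iUnion]
    exact (ae_eq_refl _).inter (ball_ae_eq_iUnion_annK hn)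
  rw [setIntegral_congr_set hae]
  refine hasSum_integral_iUnion (fun k => hL.inter (isOpen_annK n k).measurableSet) ?_ ?_
  · exact fun i j hij => (pairwise_disjoint_annK n hij).mono Set.inter_subset_right
      Set.inter_subset_right
  · refine (hf.continuousOn.integrableOn_compact (isCompact_closedBall (0 : En n) 1)).mono_set ?_
    exact Set.iUnion_subset fun k => Set.inter_subset_right.trans
      ((annK_subset_ball n k).trans ball_subset_closedBall)

theorem integral_annK_eq {n : ℕ} (u : En n → ℝ) (t : ℝ) (k : ℕ) :
    ∫ x in LamT u t ∩ annK n k, ‖x‖ ^ 2 =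
      (2 : ℝ) ^ (-((k * (n + 2) : ℕ) : ℤ)) * F0 u (t + k * Real.log 2) := by
  have hpos : (0 : ℝ) < 2 ^ k := by positivity
  have h := Measure.setIntegral_comp_smul_of_pos (volume : Measure (En n)) (fun x => ‖x‖ ^ 2)
    (LamT u t ∩ annK n k) hpos
  have hset : (2 : ℝ) ^ k • (LamT u t ∩ annK n k) = LamT u (t + k * Real.log 2) ∩ ann0 n := by
    ext y
    have hy : (2 : ℝ) ^ k • ((2 : ℝ) ^ k)⁻¹ • y = y := smul_inv_smul₀ hpos.ne' y
    rw [Set.mem_smul_set_iff_inv_smul_mem₀ hpos.ne', Set.mem_inter_iff, Set.mem_inter_iff,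
      mem_annK_iff, hy, mem_LamT_iff, mem_LamT_iff, neg_add, Real.exp_add, smul_smul,
      Real.exp_neg (k * Real.log 2), exp_nat_mul_log_two]
  rw [hset, finrank_euclideanSpace_fin] at h
  simp only [norm_smul, mul_pow, norm_pow, Real.norm_ofNat, integral_const_mul, smul_eq_mul] at h
  rw [zpow_neg, zpow_natCast, F0]
  have e : (2 : ℝ) ^ (k * (n + 2)) = (2 ^ k) ^ 2 * (2 ^ k) ^ n := by ring
  rw [e, mul_inv, mul_assoc, ← h, inv_mul_cancel_left₀ (by positivity)]

theorem setIntegral_norm_sq_le {n : ℕ} {s : Set (En n)} (hs : s ⊆ ball (0 : En n) 1) :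
    ‖∫ x in s, ‖x‖ ^ 2‖ ≤ volume.real (ball (0 : En n) 1) := by
  have hv : volume s < ⊤ := (measure_mono hs).trans_lt measure_ball_lt_top
  refine (norm_setIntegral_le_of_norm_le_const (C := 1) hv fun x hx => ?_).trans ?_
  · have : ‖x‖ < 1 := by simpa using hs hx
    rw [norm_pow, norm_norm]
    exact pow_le_one₀ (norm_nonneg _) this.le
  · rw [one_mul]
    exact measureReal_mono hs measure_ball_lt_top.ne

theorem summable_Vdef {n : ℕ} (u : En n → ℝ) (t : ℝ) :
    Summable fun k : ℕ => (2 : ℝ) ^ (-((k * (n + 2) : ℕ) : ℤ)) * F0 u (t + k * Real.log 2) *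
      ∫ τ in t..(t + k * Real.log 2), Fdef u τ := by
  set v := volume.real (ball (0 : En n) 1)
  have hlog : 0 < Real.log 2 := Real.log_pos one_lt_two
  have hhalf : ‖(1 / 2 : ℝ)‖ < 1 := by norm_num
  have hs : Summable fun k : ℕ => v * (v * Real.log 2) * ((k : ℝ) ^ 1 * (1 / 2 : ℝ) ^ k) :=
    (summable_pow_mul_geometric_of_norm_lt_one 1 hhalf).mul_left _
  refine Summable.of_norm_bounded hs fun k => ?_
  have h1 : ‖F0 u (t + k * Real.log 2)‖ ≤ v := by
    rw [F0]
    exact setIntegral_norm_sq_le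
      (Set.inter_subset_right.trans fun x hx => mem_ball_zero_iff.2 hx.2)
  have h2 : ‖∫ τ in t..(t + k * Real.log 2), Fdef u τ‖ ≤ v * (k * Real.log 2) := by
    have h := intervalIntegral.norm_integral_le_of_norm_le_const (a := t) (b := t + k * Real.log 2)
      (f := Fdef u) (C := v) fun τ _ => by
        rw [Fdef]; exact setIntegral_norm_sq_le Set.inter_subset_right
    rwa [add_sub_cancel_left, abs_of_nonneg (by positivity)] at h
  have h3 : ‖(2 : ℝ) ^ (-((k * (n + 2) : ℕ) : ℤ))‖ ≤ (1 / 2) ^ k := by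
    rw [norm_zpow, Real.norm_ofNat, one_div, inv_pow, ← zpow_natCast, ← zpow_neg]
    refine zpow_le_zpow_right₀ one_le_two ?_
    push_cast
    nlinarith [Int.natCast_nonneg k, Int.natCast_nonneg n]
  rw [norm_mul, norm_mul]
  calc _ ≤ (1 / 2) ^ k * v * (v * (k * Real.log 2)) := by gcongr
    _ = _ := by ring

/-- |I(t)| ≤ 2 η_T F(t) + C_n V(t). -/
theorem stmt_16 (n : ℕ) (hn : 2 ≤ n) :
    ∃ Cn : ℝ, ∀ u : En n → ℝ, SolutionHyp u →
      ∀ B : ℝ → Matrix (Fin n) (Fin n) ℝ, BProp u B →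
        ∀ T : ℝ, 0 < T → ∀ t, T ≤ t →
          |Idef u B t|
            ≤ 2 * (⨆ s ∈ Set.Ici T, epsd u B s) * Fdef u t + Cn * Vdef u t := by
  obtain ⟨K, -, hK⟩ := exists_frob_sub_le n hn
  refine ⟨K, fun u hu B hB T hT t ht => ?_⟩
  have ht0 : 0 < t := hT.trans_le ht
  set η := ⨆ s ∈ Set.Ici T, epsd u B s with hη
  have hL := measurableSet_LamT hu t
  let g : En n → ℝ := fun x => -((n : ℝ)⁻¹ * ‖x‖ ^ 2 + 2 * psiM (B t) x)
  have hg : Continuous g := by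
    have := continuous_psiM (B t)
    fun_prop
  have hI : Idef u B t = ∫ x in LamT u t ∩ ball (0 : En n) 1, g x :=
    setIntegral_congr_fun (hL.inter measurableSet_ball) fun x hx =>
      sum_mul_gradient_Rt hu ht0 (hB t ht0).1.1 (by simpa using (mem_ball.1 hx.2).le) hx.1
  have hF := hasSum_integral_annK hn hu t (f := fun x => ‖x‖ ^ 2) (by fun_prop)
  have hV := (summable_Vdef u t).hasSum
  rw [hI, ← (hasSum_integral_annK hn hu t hg).tsum_eq, ← Real.norm_eq_abs]
  refine tsum_of_norm_bounded ((hF.mul_left (2 * η)).add (hV.mul_left K)) fun k => ?_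
  set t' := t + k * Real.log 2 with ht'
  have htt : t ≤ t' := by
    have := Real.log_nonneg one_le_two
    rw [ht']; nlinarith [(Nat.cast_nonneg k : (0 : ℝ) ≤ k)]
  have hexp : Real.exp (t' - t) = 2 ^ k := by
    rw [ht', add_sub_cancel_left, exp_nat_mul_log_two]
  have hb : ‖∫ x in LamT u t ∩ annK n k, g x‖ ≤
      ∫ x in LamT u t ∩ annK n k, (2 * η + K * ∫ τ in t..t', Fdef u τ) * ‖x‖ ^ 2 := by
    refine norm_integral_le_of_norm_le ?_
      ((ae_restrict_iff' (hL.inter (isOpen_annK n k).measurableSet)).2 (.of_forall fun x hx => ?_))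
    · exact ((by fun_prop : Continuous fun x : En n =>
        (2 * η + K * ∫ τ in t..t', Fdef u τ) * ‖x‖ ^ 2).continuousOn.integrableOn_compact
        (isCompact_closedBall (0 : En n) 1)).mono_set
        (Set.inter_subset_right.trans ((annK_subset_ball n k).trans ball_subset_closedBall))
    · have hx' := mem_annK_iff.1 hx.2
      rw [← hexp] at hx'
      refine (abs_radial_Rt_le hn hu hB hT ht htt hx.1 hx'.1.le hx'.2.le).trans ?_
      gcongr
      exact hK u hu B hB t t' ht0 htt
  rw [integral_const_mul] at hb
  rw [← integral_annK_eq]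
  linarith

end
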